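/- Let ψ_i^j : [0,1] → ℝ (for i = 1,…,n and j = 1,…,m) be essentially bounded measurable functions, let η¹,…,ηᵐ ∈ ℝ, and let 𝒬̄ = { q ∈ 𝒬 : Σ_{i=1}^n ∫_0^1 q_i(t) ψ_i^j(t) dt ≤ ηʲ for all j = 1,…,m }. Then every extreme point q of 𝒬̄ is rationalized by a function of the form Σ_{j=1}^{m+1} λ_j · 1_{A_j}, where A_1 ⊆ A_2 ⊆ ⋯ ⊆ A_{m+1} are nested up-sets of [0,1]^n and λ_1,…,λ_{m+1} ≥ 0 with λ_1 + ⋯ + λ_{m+1} = 1. -/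

import Mathlib

open MeasureTheory

noncomputable section

/-- The closed unit cube `[0,1]^n` in `ℝⁿ`. -/
def cube (n : ℕ) : Set (Fin n → ℝ) := Set.Icc 0 1

/-- `A` is an up-set of the cube `[0,1]^n`. -/
def UpSetIn (n : ℕ) (A : Set (Fin n → ℝ)) : Prop :=
  A ⊆ cube n ∧ ∀ x ∈ A, ∀ y ∈ cube n, x ≤ y → y ∈ A

/-- `q : [0,1] → [0,1]` is nondecreasing and left-continuous. -/
def MonoLC (q : ℝ → ℝ) : Prop :=
  MonotoneOn q (Set.Icc 0 1) ∧
  (∀ t ∈ Set.Icc (0 : ℝ) 1, q t ∈ Set.Icc (0 : ℝ) 1) ∧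
  ∀ t ∈ Set.Ioc (0 : ℝ) 1, Filter.Tendsto q (nhdsWithin t (Set.Iio t)) (nhds (q t))

/-- `f : [0,1]^n → [0,1]` rationalizes the tuple `q`: for each `i`, `q i` is (a.e.) the
one-dimensional marginal of `f` in dimension `i`. -/
def RationalizesN (n : ℕ) (f : (Fin n → ℝ) → ℝ) (q : Fin n → ℝ → ℝ) : Prop :=
  AEMeasurable f (volume.restrict (cube n)) ∧
  (∀ x ∈ cube n, f x ∈ Set.Icc (0 : ℝ) 1) ∧
  ∀ i, ∀ᵐ t ∂(volume.restrict (Set.Icc (0 : ℝ) 1)),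
    q i t = ∫ x in cube n, f (Function.update x i t)

/-- The set `𝒬` of rationalizable tuples of nondecreasing left-continuous functions. -/
def QsetN (n : ℕ) : Set (Fin n → ℝ → ℝ) :=
  {q | (∀ i, MonoLC (q i)) ∧ ∃ f, RationalizesN n f q}

/-- `q` is an extreme point of a set `S` of tuples of functions on `[0,1]`, with
componentwise convex combinations (only the values on `[0,1]` matter). -/
def ExtremePtQN (n : ℕ) (S : Set (Fin n → ℝ → ℝ)) (q : Fin n → ℝ → ℝ) : Prop :=
  q ∈ S ∧ ∀ q' ∈ S, ∀ q'' ∈ S, ∀ l : ℝ, 0 < l → l < 1 →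
    (∀ i, ∀ t ∈ Set.Icc (0 : ℝ) 1, q i t = l * q' i t + (1 - l) * q'' i t) →
    ∀ i, ∀ t ∈ Set.Icc (0 : ℝ) 1, q' i t = q'' i t

/-- In finite dimension, a nonempty convex set missing a point admits a nonzero linear functional
which is either constant on the set or attains its maximum over the set and the point there. -/
theorem exists_dual_of_notMem_convex {W : Type*} [NormedAddCommGroup W] [NormedSpace ℝ W]
    [FiniteDimensional ℝ W] {C : Set W} (hC : Convex ℝ C) (hne : C.Nonempty) {x : W} (hx : x ∉ C) :
    ∃ f : W →ₗ[ℝ] ℝ, f ≠ 0 ∧ ((∀ a ∈ C, f a ≤ f x) ∨ ∃ r, ∀ a ∈ C, f a = r) := by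
  by_cases hint : (interior C).Nonempty
  · obtain ⟨f, hf, h⟩ := geometric_hahn_banach_of_nonempty_interior_point hC
      (fun h => hx (interior_subset h)) hint
    refine ⟨f.toLinearMap, ?_, Or.inl h⟩
    intro h0
    exact hf (by ext v; exact DFunLike.congr_fun h0 v)
  · rw [hC.interior_nonempty_iff_affineSpan_eq_top] at hint
    obtain ⟨a₀, ha₀⟩ := hne
    have hD : vectorSpan ℝ C < ⊤ := by
      rw [lt_top_iff_ne_top]
      intro h
      apply hint
      rw [AffineSubspace.affineSpan_eq_top_iff_vectorSpan_eq_top_of_nonempty ℝ W W ⟨a₀, ha₀⟩]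
      exact h
    obtain ⟨f, hf, hle⟩ := Submodule.exists_le_ker_of_lt_top _ hD
    refine ⟨f, hf, Or.inr ⟨f a₀, fun a ha => ?_⟩⟩
    have := hle (vsub_mem_vectorSpan ℝ ha ha₀)
    simpa [sub_eq_zero] using this

/-- In finite dimension, the mean of a random vector with values in a convex set belongs to that
set, even when the set is not closed. -/
theorem Convex.integral_mem_of_finiteDimensional {Ω E : Type*} [MeasurableSpace Ω] (ν : Measure Ω)
    [IsProbabilityMeasure ν] [NormedAddCommGroup E] [NormedSpace ℝ E] [FiniteDimensional ℝ E]
    {C : Set E} (hC : Convex ℝ C) {c : Ω → E} (hc : Integrable c ν) (hmem : ∀ᵐ s ∂ν, c s ∈ C) :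
    ∫ s, c s ∂ν ∈ C := by
  set b := ∫ s, c s ∂ν with hb
  by_contra hbC
  obtain ⟨W, hW, hmin⟩ := WellFounded.has_min (wellFounded_lt (α := Submodule ℝ E))
    {W | ∀ᵐ s ∂ν, c s - b ∈ W} ⟨⊤, by simp⟩
  have hCW : Convex ℝ {x : W | b + x ∈ C} := by
    have := (hC.translate_preimage_right b).linear_preimage W.subtype
    exact this
  have hneW : {x : W | b + x ∈ C}.Nonempty := by
    obtain ⟨s, h1, h2⟩ := (Filter.Eventually.and (Set.mem_ofPred.1 hW) hmem).exists
    exact ⟨⟨c s - b, h1⟩, by simpa using h2⟩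
  obtain ⟨f, hf, hfC⟩ := exists_dual_of_notMem_convex hCW hneW (x := 0) (by simpa using hbC)
  obtain ⟨F, hF⟩ := f.exists_extend
  have hFW : ∀ x : W, F x = f x := fun x => DFunLike.congr_fun hF x
  set G : StrongDual ℝ E := LinearMap.toContinuousLinearMap F
  have hG : ∀ x, G x = F x := fun x => rfl
  have hint : Integrable (fun s => c s - b) ν := hc.sub (integrable_const b)
  have hmean : ∫ s, F (c s - b) ∂ν = 0 := by
    have := G.integral_comp_comm hint
    simp only [hG] at this
    rw [this, integral_sub hc (integrable_const b)]
    simp [← hb]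
  have hFint : Integrable (fun s => F (c s - b)) ν := G.integrable_comp hint
  have hzero : ∀ᵐ s ∂ν, F (c s - b) = 0 := by
    rcases hfC with h | ⟨r, h⟩
    · have h1 : 0 ≤ᵐ[ν] fun s => - F (c s - b) := by
        filter_upwards [hW, hmem] with s h1 h2
        have := h ⟨_, h1⟩ (by simpa using h2)
        rw [← hFW] at this
        simpa using this
      have h2 := (integral_eq_zero_iff_of_nonneg_ae h1 hFint.neg).1 (by
        rw [integral_neg, hmean, neg_zero])
      filter_upwards [h2] with s hs
      exact neg_eq_zero.1 hs
    · have h1 : ∀ᵐ s ∂ν, F (c s - b) = r := by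
        filter_upwards [hW, hmem] with s h1 h2
        have := h ⟨_, h1⟩ (by simpa using h2)
        rw [← hFW] at this
        simpa using this
      have h2 : r = 0 := by
        rw [← hmean, integral_congr_ae h1]; simp
      simpa [h2] using h1
  refine hmin (W ⊓ LinearMap.ker F) ?_ ?_
  · filter_upwards [hW, hzero] with s h1 h2
    exact ⟨h1, h2⟩
  · refine lt_of_le_of_ne inf_le_left fun h => hf ?_
    ext x
    have hx : (x : E) ∈ W ⊓ LinearMap.ker F := by rw [h]; exact x.2
    simpa [hFW] using hx.2

/-- A bounded function orthogonal to every bounded function orthogonal to finitely many given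
bounded functions is a linear combination of these. -/
theorem exists_eq_sum_of_orthogonal {Ω ι : Type*} [MeasurableSpace Ω] [Fintype ι] (ν : Measure Ω)
    [IsProbabilityMeasure ν] (e : ι → Ω → ℝ) (he : ∀ j, Measurable (e j))
    (heb : ∀ j, ∃ M, ∀ s, |e j s| ≤ M) (a : Ω → ℝ) (ha : Measurable a)
    (hab : ∃ M, ∀ s, |a s| ≤ M)
    (H : ∀ h : Ω → ℝ, Measurable h → (∀ s, |h s| ≤ 1) → (∀ j, ∫ s, h s * e j s ∂ν = 0) →
      ∫ s, h s * a s ∂ν = 0) :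
    ∃ w : ι → ℝ, ∀ᵐ s ∂ν, a s = ∑ j, w j * e j s := by
  have memLp : ∀ f : Ω → ℝ, Measurable f → (∃ M, ∀ s, |f s| ≤ M) → MemLp f 2 ν := by
    rintro f hf ⟨M, hM⟩
    exact MemLp.of_bound hf.aestronglyMeasurable M (Filter.Eventually.of_forall hM)
  have heL := fun j => memLp _ (he j) (heb j)
  set E : ι → Lp ℝ 2 ν := fun j => (heL j).toLp (e j)
  set V := Submodule.span ℝ (Set.range E)
  have : FiniteDimensional ℝ V := FiniteDimensional.span_of_finite ℝ (Set.finite_range E)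
  set A := (memLp a ha hab).toLp a
  obtain ⟨w, hw⟩ := (Submodule.mem_span_range_iff_exists_fun ℝ).1 (V.starProjection_apply_mem A)
  set r : Ω → ℝ := fun s => a s - ∑ j, w j * e j s
  have hr : Measurable r := ha.sub (Finset.measurable_sum _ fun j _ => (he j).const_mul _)
  have hrb : ∃ M, ∀ s, |r s| ≤ M := by
    choose M hM using heb
    obtain ⟨M0, hM0⟩ := hab
    refine ⟨M0 + ∑ j, |w j| * M j, fun s => ?_⟩
    refine (abs_sub _ _).trans (add_le_add (hM0 s) ?_)
    refine (Finset.abs_sum_le_sum_abs _ _).trans (Finset.sum_le_sum fun j _ => ?_)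
    rw [abs_mul]
    exact mul_le_mul_of_nonneg_left (hM j s) (abs_nonneg _)
  have hint : ∀ f : Ω → ℝ, Measurable f → (∃ M, ∀ s, |f s| ≤ M) →
      Integrable (fun s => r s * f s) ν := fun f hf hfb =>
    (memLp r hr hrb).integrable_mul (memLp f hf hfb)
  have hrL : (memLp r hr hrb).toLp r = A - ∑ j, w j • E j := by
    have hsum : ∑ j, w j • E j =
        (memLp_finsetSum' Finset.univ fun j _ => (heL j).const_smul (w j)).toLp
          (∑ j, w j • e j) := by
      ext1
      have h1 : ∀ᵐ s ∂ν, ∀ j, (w j • E j : Lp ℝ 2 ν) s = w j * e j s := by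
        rw [ae_all_iff]
        intro j
        filter_upwards [Lp.coeFn_smul (w j) (E j), (heL j).coeFn_toLp] with s h1 h2
        rw [h1, Pi.smul_apply, h2, smul_eq_mul]
      filter_upwards [h1, Lp.coeFn_finsetSum Finset.univ fun j => w j • E j,
        (memLp_finsetSum' Finset.univ fun j _ => (heL j).const_smul (w j)).coeFn_toLp]
        with s h1 h2 h3
      rw [h2, h3]
      simp [Finset.sum_apply, h1]
    rw [hsum, ← MemLp.toLp_sub]
    congr 1
    ext s
    simp [r]
  have horth : ∀ j, ∫ s, r s * e j s ∂ν = 0 := by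
    intro j
    have h1 : inner ℝ (E j) (A - V.starProjection A) = 0 :=
      V.sub_starProjection_mem_orthogonal A _ (Submodule.subset_span ⟨j, rfl⟩)
    rw [← hw, ← hrL, L2.inner_def] at h1
    rw [← h1]
    refine integral_congr_ae ?_
    filter_upwards [(heL j).coeFn_toLp, (memLp r hr hrb).coeFn_toLp] with s h2 h3
    simp [E, h2, h3]
  obtain ⟨M, hM⟩ := hrb
  have hM' : 0 < |M| + 1 := by positivity
  have hra : ∫ s, r s * a s ∂ν = 0 := by
    have := H (fun s => r s / (|M| + 1)) (hr.div_const _) (fun s => by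
      rw [abs_div, abs_of_pos hM', div_le_one hM']
      linarith [hM s, le_abs_self M]) (fun j => by
      simp_rw [div_mul_eq_mul_div]
      rw [integral_div, horth j, zero_div])
    simp_rw [div_mul_eq_mul_div] at this
    rw [integral_div, div_eq_zero_iff] at this
    exact this.resolve_right hM'.ne'
  have hrr : ∫ s, r s * r s ∂ν = 0 := by
    have : ∀ s, r s * r s = r s * a s - ∑ j, w j * (r s * e j s) := by
      intro s
      simp only [r, mul_sub, Finset.mul_sum]
      congr 1
      exact Finset.sum_congr rfl fun j _ => by ring
    simp_rw [this]
    rw [integral_sub (hint a ha hab)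
      (integrable_finsetSum _ fun j _ => (hint _ (he j) (heb j)).const_mul _),
      integral_finsetSum _ fun j _ => (hint _ (he j) (heb j)).const_mul _]
    simp [integral_const_mul, horth, hra]
  refine ⟨w, ?_⟩
  have := (integral_eq_zero_iff_of_nonneg (fun s => mul_self_nonneg (r s))
    (hint r hr ⟨M, hM⟩)).1 hrr
  filter_upwards [this] with s hs
  have : r s = 0 := by simpa using hs
  linarith

/-- Two left-continuous functions on `(0,1]` agreeing on a dense set agree. -/
theorem eqOn_Ioc_of_leftContinuous_of_dense {F G : ℝ → ℝ} {D : Set ℝ} (hD : Dense D)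
    (hF : ∀ t ∈ Set.Ioc (0 : ℝ) 1, Filter.Tendsto F (nhdsWithin t (Set.Iio t)) (nhds (F t)))
    (hG : ∀ t ∈ Set.Ioc (0 : ℝ) 1, Filter.Tendsto G (nhdsWithin t (Set.Iio t)) (nhds (G t)))
    (h : ∀ t ∈ D, t ∈ Set.Ioc (0 : ℝ) 1 → F t = G t) :
    ∀ t ∈ Set.Ioc (0 : ℝ) 1, F t = G t := by
  intro t ht
  refine tendsto_nhds_unique_of_frequently_eq (hF t ht) (hG t ht) ?_
  rw [Filter.frequently_iff]
  intro U hU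
  obtain ⟨l, hl, hlU⟩ := (mem_nhdsLT_iff_exists_Ioo_subset' ht.1).1 hU
  obtain ⟨s, hs, hsD⟩ := hD.exists_between (max_lt (Set.mem_Iio.1 hl) ht.1)
  exact ⟨s, hlU ⟨(le_max_left _ _).trans_lt hsD.1, hsD.2⟩,
    h s hs ⟨(le_max_right _ _).trans_lt hsD.1, hsD.2.le.trans ht.2⟩⟩

/-- Exchanging the coordinates in `s` between two independent copies preserves the measure. -/
theorem measurePreserving_piecewise_swap {ι : Type*} [Fintype ι] [DecidableEq ι] (ℓ : Measure ℝ)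
    [IsProbabilityMeasure ℓ] (s : Finset ι) :
    MeasurePreserving (fun p : (ι → ℝ) × (ι → ℝ) => (s.piecewise p.2 p.1, s.piecewise p.1 p.2))
      ((Measure.pi fun _ => ℓ).prod (Measure.pi fun _ => ℓ))
      ((Measure.pi fun _ => ℓ).prod (Measure.pi fun _ => ℓ)) := by
  have h1 := measurePreserving_arrowProdEquivProdArrow ℝ ℝ ι (fun _ => ℓ) (fun _ => ℓ)
  have h2 : MeasurePreserving (fun (a : ι → ℝ × ℝ) i => if i ∈ s then (a i).swap else a i)
      (.pi fun _ => ℓ.prod ℓ) (.pi fun _ => ℓ.prod ℓ) := by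
    refine measurePreserving_pi (fun _ => ℓ.prod ℓ) (fun _ => ℓ.prod ℓ)
      (f := fun i z => if i ∈ s then z.swap else z) fun i => ?_
    by_cases hi : i ∈ s
    · simpa [hi] using Measure.measurePreserving_swap (μ := ℓ) (ν := ℓ)
    · simpa [hi] using! MeasurePreserving.id _
  convert! (h1.comp h2).comp h1.symm using 2
  ext i
  · by_cases hi : i ∈ s <;>
      simp [hi, MeasurableEquiv.arrowProdEquivProdArrow, Equiv.arrowProdEquivProdArrow]
  · by_cases hi : i ∈ s <;>
      simp [hi, MeasurableEquiv.arrowProdEquivProdArrow, Equiv.arrowProdEquivProdArrow]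

theorem measurePreserving_update_swap {ι : Type*} [Fintype ι] [DecidableEq ι] (ℓ : Measure ℝ)
    [IsProbabilityMeasure ℓ] (i : ι) :
    MeasurePreserving (fun p : (ι → ℝ) × (ι → ℝ) =>
        (Function.update p.1 i (p.2 i), Function.update p.2 i (p.1 i)))
      ((Measure.pi fun _ => ℓ).prod (Measure.pi fun _ => ℓ))
      ((Measure.pi fun _ => ℓ).prod (Measure.pi fun _ => ℓ)) := by
  convert! measurePreserving_piecewise_swap ℓ ({i} : Finset ι) using 2
  simp [Finset.piecewise_singleton]

theorem measurable_update_prod {ι : Type*} [DecidableEq ι] (i : ι) :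
    Measurable (fun p : ℝ × (ι → ℝ) => Function.update p.2 i p.1) := by
  rw [measurable_pi_iff]
  intro j
  by_cases h : j = i
  · subst h; simpa using measurable_fst
  · simp only [Function.update_of_ne h]; fun_prop

/-- Resampling one coordinate preserves the product measure. -/
theorem measurePreserving_update {ι : Type*} [Fintype ι] [DecidableEq ι] (ℓ : Measure ℝ)
    [IsProbabilityMeasure ℓ] (i : ι) :
    MeasurePreserving (fun p : ℝ × (ι → ℝ) => Function.update p.2 i p.1)
      (ℓ.prod (Measure.pi fun _ => ℓ)) (Measure.pi fun _ => ℓ) := by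
  have h1 : MeasurePreserving (fun p : (ι → ℝ) × (ι → ℝ) => (p.1 i, p.2))
      ((Measure.pi fun _ => ℓ).prod (Measure.pi fun _ => ℓ)) (ℓ.prod (Measure.pi fun _ => ℓ)) :=
    (measurePreserving_eval (fun _ => ℓ) i).prod (MeasurePreserving.id _)
  have h2 := (measurePreserving_snd (μ := Measure.pi fun _ : ι => ℓ)
    (ν := Measure.pi fun _ : ι => ℓ)).comp (measurePreserving_update_swap ℓ i)
  refine ⟨measurable_update_prod i, ?_⟩
  rw [← h1.map_eq, Measure.map_map (measurable_update_prod i) h1.measurable]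
  exact h2.map_eq

/-- Among the `[0,1]`-valued functions with prescribed integrals over the sets `S k`, there is one
of minimal `L²` norm; it satisfies the first-order optimality condition. -/
theorem exists_L2_minimizer {Ω κ : Type*} [MeasurableSpace Ω] (μ : Measure Ω)
    [IsProbabilityMeasure μ] (S : κ → Set Ω) (hS : ∀ k, MeasurableSet (S k)) (r : κ → ℝ)
    (f : Ω → ℝ) (hf : AEMeasurable f μ) (hf01 : ∀ᵐ x ∂μ, f x ∈ Set.Icc (0 : ℝ) 1)
    (hfr : ∀ k, ∫ x in S k, f x ∂μ = r k) :
    ∃ g : Ω → ℝ, Measurable g ∧ (∀ x, g x ∈ Set.Icc (0 : ℝ) 1) ∧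
      (∀ k, ∫ x in S k, g x ∂μ = r k) ∧
      ∀ p : Ω → ℝ, Measurable p → (∀ x, g x + p x ∈ Set.Icc (0 : ℝ) 1) →
        (∀ k, ∫ x in S k, p x ∂μ = 0) → 0 ≤ ∫ x, g x * p x ∂μ := by
  set c := fun k => indicatorConstLp 2 (hS k) (measure_ne_top μ (S k)) (1 : ℝ)
  set o : Lp ℝ 2 μ := Lp.const 2 μ (1 : ℝ)
  set K : Set (Lp ℝ 2 μ) := Set.Icc 0 o ∩ ⋂ k, {g | inner ℝ (c k) g = r k}
  have hcg : ∀ k (g : Lp ℝ 2 μ), inner ℝ (c k) g = ∫ x in S k, g x ∂μ := fun k g =>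
    L2.inner_indicatorConstLp_one (hS k) (measure_ne_top μ _) g
  have hIcc : ∀ g : Lp ℝ 2 μ, g ∈ Set.Icc 0 o ↔ ∀ᵐ x ∂μ, g x ∈ Set.Icc (0 : ℝ) 1 := by
    intro g
    have ho : (o : Ω → ℝ) =ᵐ[μ] fun _ => 1 := Lp.coeFn_const ..
    rw [Set.mem_Icc, ← Lp.coeFn_nonneg, ← Lp.coeFn_le]
    constructor
    · rintro ⟨h1, h2⟩
      filter_upwards [h1, h2, ho] with x h1 h2 h3
      exact ⟨h1, h3 ▸ h2⟩
    · intro h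
      constructor
      · filter_upwards [h] with x h using h.1
      · filter_upwards [h, ho] with x h h3
        rw [h3]; exact h.2
  have hmemLp : ∀ g : Ω → ℝ, AEMeasurable g μ → (∀ᵐ x ∂μ, g x ∈ Set.Icc (0 : ℝ) 1) →
      MemLp g 2 μ := fun g hg h =>
    MemLp.of_bound hg.aestronglyMeasurable 1 (by
      filter_upwards [h] with x h
      rw [Real.norm_eq_abs, abs_le]; constructor <;> linarith [h.1, h.2])
  have hmemK : ∀ (g : Ω → ℝ) (hg : AEMeasurable g μ) (h : ∀ᵐ x ∂μ, g x ∈ Set.Icc (0 : ℝ) 1),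
      (∀ k, ∫ x in S k, g x ∂μ = r k) → (hmemLp g hg h).toLp g ∈ K := by
    intro g hg h hk
    refine ⟨(hIcc _).2 ?_, Set.mem_iInter.2 fun k => ?_⟩
    · filter_upwards [h, (hmemLp g hg h).coeFn_toLp] with x h1 h2
      rwa [h2]
    · rw [Set.mem_ofPred, hcg, ← hk k]
      exact integral_congr_ae (ae_restrict_of_ae (hmemLp g hg h).coeFn_toLp)
  have hKclosed : IsClosed K := by
    refine isClosed_Icc.inter (isClosed_iInter fun k => ?_)
    exact isClosed_eq (by fun_prop) continuous_const
  have hKconv : Convex ℝ K := by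
    have hIccConv : Convex ℝ (Set.Icc 0 o) := by
      intro x hx y hy a b ha hb hab
      rw [hIcc] at *
      filter_upwards [hx, hy, Lp.coeFn_add (a • x) (b • y), Lp.coeFn_smul a x,
        Lp.coeFn_smul b y] with z h1 h2 h3 h4 h5
      rw [h3, Pi.add_apply, h4, h5]
      exact convex_Icc (0 : ℝ) 1 h1 h2 ha hb hab
    refine hIccConv.inter (convex_iInter fun k => ?_)
    intro x hx y hy a b _ _ hab
    simp only [Set.mem_ofPred] at *
    rw [inner_add_right, inner_smul_right, inner_smul_right, hx, hy, ← add_mul, hab, one_mul]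
  obtain ⟨v, hvK, hv⟩ := exists_norm_eq_iInf_of_complete_convex ⟨_, hmemK f hf hf01 hfr⟩
    hKclosed.isComplete hKconv 0
  rw [norm_eq_iInf_iff_real_inner_le_zero hKconv hvK] at hv
  have hv01 := (hIcc v).1 hvK.1
  set g : Ω → ℝ := fun x => max 0 (min 1 ((Lp.aestronglyMeasurable v).mk v x))
  have hgm : Measurable g := measurable_const.max
    (measurable_const.min (Lp.aestronglyMeasurable v).stronglyMeasurable_mk.measurable)
  have hg01 : ∀ x, g x ∈ Set.Icc (0 : ℝ) 1 := fun x =>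
    ⟨le_max_left _ _, max_le zero_le_one (min_le_left _ _)⟩
  have hgv : g =ᵐ[μ] v := by
    filter_upwards [hv01, (Lp.aestronglyMeasurable v).ae_eq_mk] with x h1 h2
    simp only [g, ← h2]
    rw [min_eq_right h1.2, max_eq_right h1.1]
  have hgr : ∀ k, ∫ x in S k, g x ∂μ = r k := fun k => by
    rw [← (Set.mem_iInter.1 hvK.2 k : inner ℝ (c k) v = r k), hcg]
    exact integral_congr_ae (ae_restrict_of_ae hgv)
  refine ⟨g, hgm, hg01, hgr, fun p hp hgp hpk => ?_⟩
  have hgI : Integrable g μ :=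
    (hmemLp g hgm.aemeasurable (Filter.Eventually.of_forall hg01)).integrable (by norm_num)
  have hsum := hmemLp (fun x => g x + p x) (hgm.add hp).aemeasurable
    (Filter.Eventually.of_forall hgp)
  have hpI : Integrable p μ := by
    convert (hsum.integrable (by norm_num)).sub hgI using 1
    ext x
    simp
  have hw := hv _ (hmemK (fun x => g x + p x) (hgm.add hp).aemeasurable
    (Filter.Eventually.of_forall hgp) fun k => by
      rw [integral_add hgI.integrableOn hpI.integrableOn, hgr, hpk, add_zero])
  rw [zero_sub, inner_neg_left, Left.neg_nonpos_iff, L2.inner_def] at hw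
  refine hw.trans_eq (integral_congr_ae ?_)
  filter_upwards [hgv, hsum.coeFn_toLp, Lp.coeFn_sub (hsum.toLp _) v] with x h1 h2 h3
  rw [h3, Pi.sub_apply, h2, ← h1]
  simp [mul_comm]

theorem integrable_of_measurable_of_abs_le {Ω : Type*} [MeasurableSpace Ω] {ν : Measure Ω}
    [IsFiniteMeasure ν] {f : Ω → ℝ} (hf : Measurable f) (C : ℝ) (h : ∀ x, |f x| ≤ C) :
    Integrable f ν :=
  Integrable.of_bound hf.aestronglyMeasurable C (Filter.Eventually.of_forall h)

theorem update_swap_involutive {ι : Type*} [DecidableEq ι] (i : ι) (p : (ι → ℝ) × (ι → ℝ)) :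
    (fun p : (ι → ℝ) × (ι → ℝ) =>
      (Function.update p.1 i (p.2 i), Function.update p.2 i (p.1 i)))
      (Function.update p.1 i (p.2 i), Function.update p.2 i (p.1 i)) = p := by
  ext j <;> by_cases hj : j = i <;> simp [hj]

section Resampling

variable {ι : Type*} [Fintype ι] [DecidableEq ι] (ℓ : Measure ℝ) [IsProbabilityMeasure ℓ]

theorem integral_eq_integral_update (i : ι) {F : (ι → ℝ) → ℝ}
    (hF : Integrable F (Measure.pi fun _ => ℓ)) :
    ∫ x, F x ∂(Measure.pi fun _ => ℓ) =
      ∫ t, ∫ x, F (Function.update x i t) ∂(Measure.pi fun _ => ℓ) ∂ℓ := by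
  have h := measurePreserving_update ℓ i
  rw [← h.map_eq] at hF
  conv_lhs => rw [← h.map_eq, integral_map h.aemeasurable hF.aestronglyMeasurable]
  rw [integral_prod]
  exact hF.comp_measurable h.measurable

theorem ae_iff_ae_update (i : ι) {R : (ι → ℝ) → Prop} (hR : MeasurableSet {x | R x}) :
    (∀ᵐ x ∂(Measure.pi fun _ => ℓ), R x) ↔
      ∀ᵐ t ∂ℓ, ∀ᵐ x ∂(Measure.pi fun _ => ℓ), R (Function.update x i t) := by
  have h := measurePreserving_update ℓ i
  conv_lhs => rw [← h.map_eq, ae_map_iff h.aemeasurable hR]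
  exact Measure.ae_prod_iff_ae_ae (h.measurable hR)

theorem ae_ae_update (i : ι) {R : (ι → ℝ) → Prop}
    (hR : ∀ᵐ x ∂(Measure.pi fun _ => ℓ), R x) :
    ∀ᵐ t ∂ℓ, ∀ᵐ x ∂(Measure.pi fun _ => ℓ), R (Function.update x i t) :=
  Measure.ae_ae_of_ae_prod ((measurePreserving_update ℓ i).quasiMeasurePreserving.ae hR)

theorem setIntegral_eval_preimage (i : ι) {F : (ι → ℝ) → ℝ}
    (hF : Integrable F (Measure.pi fun _ => ℓ)) {B : Set ℝ} (hB : MeasurableSet B) :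
    ∫ x in Function.eval i ⁻¹' B, F x ∂(Measure.pi fun _ => ℓ) =
      ∫ t in B, ∫ x, F (Function.update x i t) ∂(Measure.pi fun _ => ℓ) ∂ℓ := by
  have hB' : MeasurableSet (Function.eval i ⁻¹' B : Set (ι → ℝ)) := measurable_pi_apply i hB
  rw [← integral_indicator hB', integral_eq_integral_update ℓ i (hF.indicator hB'),
    ← integral_indicator hB]
  congr 1
  ext t
  by_cases ht : t ∈ B
  · simp [Set.indicator, ht]
  · simp [Set.indicator, ht]

theorem measurable_marginal (i : ι) {g : (ι → ℝ) → ℝ} (hg : Measurable g) :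
    Measurable fun t => ∫ x, g (Function.update x i t) ∂(Measure.pi fun _ => ℓ) :=
  (StronglyMeasurable.integral_prod_right
    (f := fun t (x : ι → ℝ) => g (Function.update x i t))
    (hg.comp (measurable_update_prod i)).stronglyMeasurable).measurable

/-- The marginal of `g` is determined by the integrals of `g` over slabs. -/
theorem ae_eq_marginal (i : ι) {g : (ι → ℝ) → ℝ} (hg : Measurable g)
    (hg01 : ∀ x, g x ∈ Set.Icc (0 : ℝ) 1) {q : ℝ → ℝ} (hq : Integrable q ℓ)
    (h : ∀ B, MeasurableSet B →
      ∫ x in Function.eval i ⁻¹' B, g x ∂(Measure.pi fun _ => ℓ) = ∫ t in B, q t ∂ℓ) :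
    ∀ᵐ t ∂ℓ, q t = ∫ x, g (Function.update x i t) ∂(Measure.pi fun _ => ℓ) := by
  have habs : ∀ x, |g x| ≤ 1 := fun x => by
    rw [abs_le]; constructor <;> linarith [(hg01 x).1, (hg01 x).2]
  have hgI : Integrable g (Measure.pi fun _ : ι => ℓ) :=
    integrable_of_measurable_of_abs_le hg 1 habs
  refine Integrable.ae_eq_of_forall_setIntegral_eq _ _ hq ?_ fun B hB _ => ?_
  · refine integrable_of_measurable_of_abs_le (measurable_marginal ℓ i hg) 1 fun t => ?_
    simpa using norm_integral_le_of_norm_le_const (μ := Measure.pi fun _ : ι => ℓ)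
      (f := fun x => g (Function.update x i t)) (C := 1) (Filter.Eventually.of_forall fun x => habs (Function.update x i t))
  · rw [← h B hB, setIntegral_eval_preimage ℓ i hgI hB]

/-- If a `[0,1]`-valued function `g` satisfies the first-order condition for minimality of the
`L²` norm given its marginals, and its `i`-th marginal is nondecreasing, then `g` is nondecreasing
in the `i`-th coordinate, almost everywhere. -/
theorem ae_monotone_coordinate_of_optimal {g : (ι → ℝ) → ℝ} (hg : Measurable g)
    (hg01 : ∀ x, g x ∈ Set.Icc (0 : ℝ) 1)
    (hopt : ∀ p : (ι → ℝ) → ℝ, Measurable p → (∀ x, g x + p x ∈ Set.Icc (0 : ℝ) 1) →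
      (∀ j B, MeasurableSet B →
        ∫ x in Function.eval j ⁻¹' B, p x ∂(Measure.pi fun _ => ℓ) = 0) →
      0 ≤ ∫ x, g x * p x ∂(Measure.pi fun _ => ℓ))
    (i : ι) (hmono : ∀ᵐ b ∂ℓ, ∀ᵐ a ∂ℓ, a < b →
      ∫ x, g (Function.update x i a) ∂(Measure.pi fun _ => ℓ) ≤
        ∫ x, g (Function.update x i b) ∂(Measure.pi fun _ => ℓ)) :
    ∀ᵐ p ∂((Measure.pi fun _ : ι => ℓ).prod (Measure.pi fun _ : ι => ℓ)),
      p.2 i < p.1 i → g p.2 ≤ g (Function.update p.2 i (p.1 i)) := by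
  set μ : Measure (ι → ℝ) := Measure.pi fun _ => ℓ with hμ
  set σ : (ι → ℝ) × (ι → ℝ) → (ι → ℝ) × (ι → ℝ) := fun p =>
    (Function.update p.1 i (p.2 i), Function.update p.2 i (p.1 i)) with hσ
  have hσmp : MeasurePreserving σ (μ.prod μ) (μ.prod μ) := measurePreserving_update_swap ℓ i
  have hσσ : ∀ p, σ (σ p) = p := update_swap_involutive i
  set α : ℝ → ℝ → ℝ := fun a b =>
    ∫ z, max (g (Function.update z i a) - g (Function.update z i b)) 0 ∂μ with hα
  set D : (ι → ℝ) → ℝ → ℝ := fun x b => g x - g (Function.update x i b) with hD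
  have hup : ∀ (x : ι → ℝ) a b, D (Function.update x i a) b =
      g (Function.update x i a) - g (Function.update x i b) := by intro x a b; simp [hD]
  have habs : ∀ x y, |g x - g y| ≤ 1 := fun x y => by
    rw [abs_le]; constructor <;> linarith [(hg01 x).1, (hg01 x).2, (hg01 y).1, (hg01 y).2]
  have hmax01 : ∀ x y, max (g x - g y) 0 ∈ Set.Icc (0 : ℝ) 1 := fun x y =>
    ⟨le_max_right _ _, max_le ((abs_le.1 (habs x y)).2) zero_le_one⟩
  have hgu : ∀ a, Measurable fun z : ι → ℝ => g (Function.update z i a) := fun a =>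
    hg.comp ((measurable_update_prod i).comp (measurable_const.prodMk measurable_id))
  have hmaxm : ∀ a b, Measurable fun z : ι → ℝ =>
      max (g (Function.update z i a) - g (Function.update z i b)) 0 := fun a b =>
    ((hgu a).sub (hgu b)).max measurable_const
  have hmaxI : ∀ a b, Integrable (fun z : ι → ℝ =>
      max (g (Function.update z i a) - g (Function.update z i b)) 0) μ := fun a b =>
    integrable_of_measurable_of_abs_le (hmaxm a b) 1 fun z => by
      rw [abs_of_nonneg (hmax01 _ _).1]; exact (hmax01 _ _).2
  have hα0 : ∀ a b, 0 ≤ α a b := fun a b => integral_nonneg fun z => (hmax01 _ _).1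
  have hα1 : ∀ a b, α a b ≤ 1 := fun a b => by
    have := integral_mono (hmaxI a b) (integrable_const (1 : ℝ)) fun z => (hmax01 _ _).2
    simpa using this
  have hαm : Measurable fun p : ℝ × ℝ => α p.1 p.2 := by
    refine (StronglyMeasurable.integral_prod_right (f := fun (p : ℝ × ℝ) (z : ι → ℝ) =>
      max (g (Function.update z i p.1) - g (Function.update z i p.2)) 0)
      (Measurable.stronglyMeasurable ?_)).measurable
    have h1 : Measurable fun w : (ℝ × ℝ) × (ι → ℝ) => g (Function.update w.2 i w.1.1) :=
      hg.comp ((measurable_update_prod i).comp (by fun_prop :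
        Measurable fun w : (ℝ × ℝ) × (ι → ℝ) => (w.1.1, w.2)))
    have h2 : Measurable fun w : (ℝ × ℝ) × (ι → ℝ) => g (Function.update w.2 i w.1.2) :=
      hg.comp ((measurable_update_prod i).comp (by fun_prop :
        Measurable fun w : (ℝ × ℝ) × (ι → ℝ) => (w.1.2, w.2)))
    exact (h1.sub h2).max measurable_const
  set u : (ι → ℝ) × (ι → ℝ) → ℝ := fun p =>
    if p.2 i < p.1 i then α (p.1 i) (p.2 i) * max (D p.2 (p.1 i)) 0 -
      α (p.2 i) (p.1 i) * max (-D p.2 (p.1 i)) 0 else 0 with hu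
  have hDm : Measurable fun p : (ι → ℝ) × (ι → ℝ) => D p.2 (p.1 i) :=
    (hg.comp measurable_snd).sub (hg.comp (measurable_snd.comp hσmp.measurable))
  have hum : Measurable u := by
    refine Measurable.ite (measurableSet_lt (by fun_prop) (by fun_prop)) ?_ measurable_const
    have h1 : Measurable fun p : (ι → ℝ) × (ι → ℝ) => α (p.1 i) (p.2 i) :=
      hαm.comp (by fun_prop : Measurable fun p : (ι → ℝ) × (ι → ℝ) => (p.1 i, p.2 i))
    have h2 : Measurable fun p : (ι → ℝ) × (ι → ℝ) => α (p.2 i) (p.1 i) :=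
      hαm.comp (by fun_prop : Measurable fun p : (ι → ℝ) × (ι → ℝ) => (p.2 i, p.1 i))
    exact (h1.mul (hDm.max measurable_const)).sub (h2.mul (hDm.neg.max measurable_const))
  have hDσ : ∀ p, D (σ p).2 ((σ p).1 i) = - D p.2 (p.1 i) := by intro p; simp [hD, hσ]
  have hubd : ∀ p, |u p| ≤ 1 := by
    intro p
    simp only [hu]
    split_ifs
    · have h1 := hmax01 p.2 (Function.update p.2 i (p.1 i))
      have h2 := hmax01 (Function.update p.2 i (p.1 i)) p.2
      have h3 : max (-D p.2 (p.1 i)) 0 ∈ Set.Icc (0 : ℝ) 1 := by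
        rwa [hD, neg_sub]
      have h1' : max (D p.2 (p.1 i)) 0 ∈ Set.Icc (0 : ℝ) 1 := h1
      have e1 := mul_le_one₀ (hα1 (p.1 i) (p.2 i)) h1'.1 h1'.2
      have e2 := mul_le_one₀ (hα1 (p.2 i) (p.1 i)) h3.1 h3.2
      have e3 := mul_nonneg (hα0 (p.1 i) (p.2 i)) h1'.1
      have e4 := mul_nonneg (hα0 (p.2 i) (p.1 i)) h3.1
      rw [abs_le]; constructor <;> linarith
    · simp
  have huI : Integrable u (μ.prod μ) := integrable_of_measurable_of_abs_le hum 1 hubd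
  -- the perturbation moves mass along `σ`
  have hv : ∀ p, u (σ p) - u p ∈ Set.Icc (-g p.2) (1 - g p.2) := by
    intro p
    have h0 := hg01 p.2
    have h1 := hg01 (Function.update p.2 i (p.1 i))
    have hp1 : (σ p).1 i = p.2 i := by simp [hσ]
    have hp2 : (σ p).2 i = p.1 i := by simp [hσ]
    have hDσ' : D (σ p).2 (p.2 i) = -D p.2 (p.1 i) := by
      have := hDσ p
      rwa [hp1] at this
    have hDe : D p.2 (p.1 i) = g p.2 - g (Function.update p.2 i (p.1 i)) := rfl
    have a1 := hα0 (p.1 i) (p.2 i)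
    have a2 := hα1 (p.1 i) (p.2 i)
    have a3 := hα0 (p.2 i) (p.1 i)
    have a4 := hα1 (p.2 i) (p.1 i)
    have m1 : max (D p.2 (p.1 i)) 0 ≤ g p.2 := max_le (by rw [hDe]; linarith [h1.1]) h0.1
    have m2 : max (-D p.2 (p.1 i)) 0 ≤ 1 - g p.2 :=
      max_le (by rw [hDe]; linarith [h1.2]) (by linarith [h0.2])
    have m3 : 0 ≤ max (D p.2 (p.1 i)) 0 := le_max_right _ _
    have m4 : 0 ≤ max (-D p.2 (p.1 i)) 0 := le_max_right _ _
    have n1 := mul_le_of_le_one_left m3 a2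
    have n2 := mul_le_of_le_one_left m4 a4
    have n3 := mul_nonneg a1 m3
    have n4 := mul_nonneg a3 m4
    have n5 := mul_le_of_le_one_left m3 a4
    have n6 := mul_le_of_le_one_left m4 a2
    have n7 := mul_nonneg a3 m3
    have n8 := mul_nonneg a1 m4
    simp only [hu, hp1, hp2, hDσ', neg_neg]
    rcases lt_trichotomy (p.2 i) (p.1 i) with h | h | h
    · rw [if_neg h.not_gt, if_pos h]
      constructor <;> linarith
    · simp only [h, lt_self_iff_false, if_false]
      constructor <;> linarith [h0.1, h0.2]
    · rw [if_pos h, if_neg h.not_gt]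
      constructor <;> linarith
  have hvI : Integrable (fun p => u (σ p) - u p) (μ.prod μ) :=
    (hσmp.integrable_comp_of_integrable huI).sub huI
  set P : (ι → ℝ) → ℝ := fun x => ∫ y, (u (σ (y, x)) - u (y, x)) ∂μ with hP
  have hPm : Measurable P := (StronglyMeasurable.integral_prod_left
    (f := fun y x => u (σ (y, x)) - u (y, x))
    ((hum.comp hσmp.measurable).sub hum).stronglyMeasurable).measurable
  have hsec : ∀ x, Integrable (fun y => u (σ (y, x)) - u (y, x)) μ := fun x =>
    integrable_of_measurable_of_abs_le
      (((hum.comp hσmp.measurable).sub hum).comp (by fun_prop :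
        Measurable fun y : ι → ℝ => (y, x))) 2 fun y =>
      (abs_sub _ _).trans (by linarith [hubd (σ (y, x)), hubd (y, x)])
  have hP01 : ∀ x, g x + P x ∈ Set.Icc (0 : ℝ) 1 := by
    intro x
    have h1 := integral_mono (integrable_const (-g x)) (hsec x) fun y => (hv (y, x)).1
    have h2 := integral_mono (hsec x) (integrable_const (1 - g x)) fun y => (hv (y, x)).2
    simp only [integral_const, probReal_univ, one_smul] at h1 h2
    constructor
    · linarith
    · linarith
  have hkey : ∀ χ : (ι → ℝ) → ℝ, Measurable χ → (∀ x, |χ x| ≤ 1) →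
      ∫ x, χ x * P x ∂μ = ∫ p, u p * (χ (σ p).2 - χ p.2) ∂(μ.prod μ) := by
    intro χ hχ hχ1
    have hχ2 : Measurable fun p : (ι → ℝ) × (ι → ℝ) => χ p.2 := hχ.comp measurable_snd
    have b1 : ∀ p p' : (ι → ℝ) × (ι → ℝ), |u p * χ p'.2| ≤ 1 := fun p p' => by
      rw [abs_mul]; exact mul_le_one₀ (hubd p) (abs_nonneg _) (hχ1 _)
    have I1 : Integrable (fun p => u (σ p) * χ p.2) (μ.prod μ) :=
      integrable_of_measurable_of_abs_le ((hum.comp hσmp.measurable).mul hχ2) 1 fun p => b1 _ _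
    have I2 : Integrable (fun p => u p * χ p.2) (μ.prod μ) :=
      integrable_of_measurable_of_abs_le (hum.mul hχ2) 1 fun p => b1 _ _
    have I3 : Integrable (fun p => u p * χ (σ p).2) (μ.prod μ) :=
      integrable_of_measurable_of_abs_le (hum.mul (hχ2.comp hσmp.measurable)) 1 fun p => b1 _ _
    have e1 : ∫ x, χ x * P x ∂μ = ∫ p, (u (σ p) * χ p.2 - u p * χ p.2) ∂(μ.prod μ) := by
      have I12 : Integrable (fun p => u (σ p) * χ p.2 - u p * χ p.2) (μ.prod μ) := I1.sub I2
      rw [integral_prod_symm _ I12]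
      refine integral_congr_ae (Filter.Eventually.of_forall fun x => ?_)
      simp only [hP]
      rw [← integral_const_mul]
      congr 1
      ext y
      ring
    have e2 : ∫ p, u (σ p) * χ p.2 ∂(μ.prod μ) = ∫ p, u p * χ (σ p).2 ∂(μ.prod μ) := by
      conv_rhs => rw [← hσmp.map_eq, integral_map hσmp.aemeasurable
        (by rw [hσmp.map_eq]; exact I3.aestronglyMeasurable)]
      simp_rw [hσσ]
    rw [e1, integral_sub I1 I2, e2, ← integral_sub I3 I2]
    congr 1
    ext p
    ring
  have hαD : ∀ (a b : ℝ), ∫ z, max (D (Function.update z i a) b) 0 ∂μ = α a b := by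
    intro a b; simp only [hup, hα]
  have hαD' : ∀ (a b : ℝ), ∫ z, max (-D (Function.update z i a) b) 0 ∂μ = α b a := by
    intro a b; simp only [hup, hα, neg_sub]
  have hPmarg : ∀ j B, MeasurableSet B → ∫ x in Function.eval j ⁻¹' B, P x ∂μ = 0 := by
    intro j B hB
    have hB' : MeasurableSet (Function.eval j ⁻¹' B : Set (ι → ℝ)) := measurable_pi_apply j hB
    set χ : (ι → ℝ) → ℝ := (Function.eval j ⁻¹' B).indicator 1 with hχ
    have hχe : ∀ x, χ x = B.indicator 1 (x j) := fun x => rfl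
    have hχm : Measurable χ := measurable_one.indicator hB'
    have hχ1 : ∀ x, |χ x| ≤ 1 := fun x => by
      by_cases hx : x ∈ (Function.eval j ⁻¹' B : Set (ι → ℝ)) <;> simp [hχ, hx]
    have e := hkey χ hχm hχ1
    rw [← integral_indicator hB']
    have e0 : ∀ x, (Function.eval j ⁻¹' B).indicator P x = χ x * P x := fun x => by
      by_cases hx : x ∈ (Function.eval j ⁻¹' B : Set (ι → ℝ)) <;> simp [hχ, hx]
    simp_rw [e0, e]
    by_cases hj : j = i
    · subst hj
      have hI : Integrable (fun p => u p * (χ (σ p).2 - χ p.2)) (μ.prod μ) := by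
        refine integrable_of_measurable_of_abs_le
          (hum.mul (((hχm.comp measurable_snd).comp hσmp.measurable).sub
            (hχm.comp measurable_snd))) 2 fun p => ?_
        rw [abs_mul]
        refine (mul_le_of_le_one_left (abs_nonneg _) (hubd p)).trans ((abs_sub _ _).trans ?_)
        linarith [hχ1 (σ p).2, hχ1 p.2]
      rw [integral_prod _ hI]
      refine integral_eq_zero_of_ae ?_
      filter_upwards [hI.prod_right_ae] with y hy
      rw [integral_eq_integral_update ℓ j hy]
      refine integral_eq_zero_of_ae (Filter.Eventually.of_forall fun t => ?_)
      have : ∀ z : ι → ℝ, u (y, Function.update z j t) *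
          (χ (σ (y, Function.update z j t)).2 - χ (Function.update z j t)) =
          (if t < y j then (B.indicator 1 (y j) - B.indicator 1 t : ℝ) else 0) *
            (α (y j) t * max (D (Function.update z j t) (y j)) 0 -
              α t (y j) * max (-D (Function.update z j t) (y j)) 0) := by
        intro z
        have c1 : χ (σ (y, Function.update z j t)).2 = B.indicator 1 (y j) := by
          simp [hχe, hσ]
        have c2 : χ (Function.update z j t) = B.indicator 1 t := by
          simp [hχe]
        rw [c1, c2]
        simp only [hu, Function.update_self]
        split_ifs <;> ring
      simp only [this, Pi.zero_apply]
      rw [integral_const_mul, integral_sub, integral_const_mul, integral_const_mul, hαD, hαD',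
        mul_comm (α t (y j)), sub_self, mul_zero]
      · exact Integrable.const_mul (by simpa only [hup] using hmaxI t (y j)) _
      · refine Integrable.const_mul ?_ _
        simpa only [hup, neg_sub] using hmaxI (y j) t
    · refine integral_eq_zero_of_ae (Filter.Eventually.of_forall fun p => ?_)
      have : χ (σ p).2 = χ p.2 := by
        simp [hχe, hσ, Function.update_of_ne hj]
      simp [this]
  have hfo := hopt P hPm hP01 hPmarg
  have hg1 : ∀ x, |g x| ≤ 1 := fun x => by
    rw [abs_le]; constructor <;> linarith [(hg01 x).1, (hg01 x).2]
  rw [hkey g hg hg1] at hfo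
  have hgσ : ∀ p, g (σ p).2 - g p.2 = - D p.2 (p.1 i) := by intro p; simp [hσ, hD]
  simp_rw [hgσ, mul_neg] at hfo
  rw [integral_neg] at hfo
  have hud : ∀ p, u p * D p.2 (p.1 i) =
      if p.2 i < p.1 i then α (p.1 i) (p.2 i) * max (D p.2 (p.1 i)) 0 ^ 2 +
      α (p.2 i) (p.1 i) * max (-D p.2 (p.1 i)) 0 ^ 2 else 0 := by
    intro p
    simp only [hu]
    split_ifs
    · rcases le_total 0 (D p.2 (p.1 i)) with h | h
      · rw [max_eq_left h, max_eq_right (by linarith)]; ring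
      · rw [max_eq_right h, max_eq_left (by linarith)]; ring
    · simp
  have hud0 : 0 ≤ fun p => u p * D p.2 (p.1 i) := by
    intro p
    simp only [hud, Pi.zero_apply]
    split_ifs
    · have := hα0 (p.1 i) (p.2 i)
      have := hα0 (p.2 i) (p.1 i)
      positivity
    · exact le_rfl
  have hudI : Integrable (fun p => u p * D p.2 (p.1 i)) (μ.prod μ) :=
    integrable_of_measurable_of_abs_le (hum.mul hDm) 1 fun p => by
      rw [abs_mul]; exact mul_le_one₀ (hubd p) (abs_nonneg _) (habs _ _)
  have hae := (integral_eq_zero_iff_of_nonneg hud0 hudI).1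
    (le_antisymm (by linarith) (integral_nonneg hud0))
  rw [Measure.ae_prod_iff_ae_ae]
  swap
  · refine (measurableSet_lt (by fun_prop) (by fun_prop)).imp (measurableSet_le
      (hg.comp measurable_snd) (hg.comp (measurable_snd.comp hσmp.measurable)))
  have hmono' : ∀ᵐ y ∂μ, ∀ᵐ a ∂ℓ, a < y i → α a (y i) ≤ α (y i) a := by
    have := (measurePreserving_eval (fun _ : ι => ℓ) i).quasiMeasurePreserving.ae hmono
    filter_upwards [this] with y hy
    filter_upwards [hy] with a ha hay
    have h1 : α a (y i) - α (y i) a = ∫ z, g (Function.update z i a) ∂μ -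
        ∫ z, g (Function.update z i (y i)) ∂μ := by
      rw [← integral_sub (hmaxI _ _) (hmaxI _ _), ← integral_sub]
      · congr 1
        ext z
        rcases le_total (g (Function.update z i a)) (g (Function.update z i (y i))) with h | h
        · rw [max_eq_right (by linarith), max_eq_left (by linarith)]; ring
        · rw [max_eq_left (by linarith), max_eq_right (by linarith)]; ring
      · exact integrable_of_measurable_of_abs_le (hgu _) 1 fun z => hg1 _
      · exact integrable_of_measurable_of_abs_le (hgu _) 1 fun z => hg1 _
    have := ha hay
    simp only [Function.eval] at this
    linarith
  filter_upwards [Measure.ae_ae_of_ae_prod hae, hmono'] with y hy hym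
  rw [ae_iff_ae_update ℓ i]
  swap
  · refine (measurableSet_lt (by fun_prop) (by fun_prop)).imp (measurableSet_le hg (hgu _))
  filter_upwards [ae_ae_update ℓ i hy, hym] with t ht htm
  by_cases hty : t < y i
  · have hzero : α t (y i) = 0 := by
      have h1 : ∀ᵐ z ∂μ, α t (y i) *
          max (g (Function.update z i t) - g (Function.update z i (y i))) 0 = 0 := by
        filter_upwards [ht] with z hz
        have hz' := hud (y, Function.update z i t)
        simp only [Pi.zero_apply] at hz
        rw [hz] at hz'
        simp only [Function.update_self, if_pos hty, hup] at hz'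
        set M := max (g (Function.update z i t) - g (Function.update z i (y i))) 0
        have hM : 0 ≤ M := le_max_right _ _
        have k1 := hα0 t (y i)
        have k2 := htm hty
        have k3 : 0 ≤ α t (y i) *
          max (-(g (Function.update z i t) - g (Function.update z i (y i)))) 0 ^ 2 := by positivity
        have k4 : α (y i) t * M ^ 2 ≤ 0 := by linarith
        have k5 : α t (y i) * M ^ 2 ≤ α (y i) t * M ^ 2 := by gcongr
        have k6 : α t (y i) * M ^ 2 = 0 := le_antisymm (k5.trans k4) (by positivity)
        rcases mul_eq_zero.1 k6 with h | h
        · rw [h, zero_mul]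
        · rw [pow_eq_zero_iff two_ne_zero] at h; rw [h, mul_zero]
      have h2 := integral_congr_ae h1
      rw [integral_const_mul, integral_zero] at h2
      exact mul_self_eq_zero.1 h2
    have h3 := (integral_eq_zero_iff_of_nonneg (fun z => (hmax01 _ _).1)
      (hmaxI t (y i))).1 hzero
    filter_upwards [h3] with z hz _
    have : g (Function.update z i t) - g (Function.update z i (y i)) ≤ 0 := by
      rw [← max_eq_right_iff]; exact hz
    simpa using this
  · exact Filter.Eventually.of_forall fun z h => absurd (by simpa using h) hty

end Resampling

section Monotone

variable {ι : Type*} [Fintype ι] [DecidableEq ι]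

/-- A tuple of a.e. nondecreasing functions which are the marginals of some `[0,1]`-valued function
are the marginals of a function which is a.e. nondecreasing in each coordinate. -/
theorem exists_ae_monotone_of_marginals (ℓ : Measure ℝ) [IsProbabilityMeasure ℓ]
    {q : ι → ℝ → ℝ} (hqI : ∀ i, Integrable (q i) ℓ)
    (hmono : ∀ i, ∀ᵐ b ∂ℓ, ∀ᵐ a ∂ℓ, a < b → q i a ≤ q i b) {f : (ι → ℝ) → ℝ}
    (hf : AEMeasurable f (Measure.pi fun _ => ℓ))
    (hf01 : ∀ᵐ x ∂(Measure.pi fun _ => ℓ), f x ∈ Set.Icc (0 : ℝ) 1)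
    (hfq : ∀ i, ∀ᵐ t ∂ℓ, q i t = ∫ x, f (Function.update x i t) ∂(Measure.pi fun _ => ℓ)) :
    ∃ g : (ι → ℝ) → ℝ, Measurable g ∧ (∀ x, g x ∈ Set.Icc (0 : ℝ) 1) ∧
      (∀ i, ∀ᵐ t ∂ℓ, q i t = ∫ x, g (Function.update x i t) ∂(Measure.pi fun _ => ℓ)) ∧
      ∀ i, ∀ᵐ p ∂((Measure.pi fun _ : ι => ℓ).prod (Measure.pi fun _ : ι => ℓ)),
        p.2 i < p.1 i → g p.2 ≤ g (Function.update p.2 i (p.1 i)) := by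
  have hfI : Integrable f (Measure.pi fun _ : ι => ℓ) :=
    Integrable.of_bound hf.aestronglyMeasurable 1 (hf01.mono fun x hx => by
      rw [Real.norm_eq_abs, abs_of_nonneg hx.1]; exact hx.2)
  obtain ⟨g, hg, hg01, hgr, hopt⟩ := exists_L2_minimizer (Measure.pi fun _ : ι => ℓ)
    (fun k : ι × {B : Set ℝ // MeasurableSet B} => Function.eval k.1 ⁻¹' (k.2 : Set ℝ))
    (fun k => measurable_pi_apply k.1 k.2.2) (fun k => ∫ t in (k.2 : Set ℝ), q k.1 t ∂ℓ)
    f hf hf01 fun k => by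
      rw [setIntegral_eval_preimage ℓ k.1 hfI k.2.2]
      refine integral_congr_ae (ae_restrict_of_ae ?_)
      filter_upwards [hfq k.1] with t ht using ht.symm
  have hmarg : ∀ i, ∀ᵐ t ∂ℓ, q i t =
      ∫ x, g (Function.update x i t) ∂(Measure.pi fun _ => ℓ) := fun i =>
    ae_eq_marginal ℓ i hg hg01 (hqI i) fun B hB => hgr (i, ⟨B, hB⟩)
  refine ⟨g, hg, hg01, hmarg, fun i => ae_monotone_coordinate_of_optimal ℓ hg hg01
    (fun p hp hp01 hp0 => hopt p hp hp01 fun k => hp0 k.1 k.2 k.2.2) i ?_⟩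
  filter_upwards [hmono i, hmarg i] with b hb hb'
  filter_upwards [hb, hmarg i] with a ha ha' hab
  rw [← ha', ← hb']
  exact ha hab

theorem ae_le_of_ae_monotone_coordinates (ℓ : Measure ℝ) [IsProbabilityMeasure ℓ]
    {g : (ι → ℝ) → ℝ}
    (h : ∀ i, ∀ᵐ p ∂((Measure.pi fun _ : ι => ℓ).prod (Measure.pi fun _ : ι => ℓ)),
        p.2 i < p.1 i → g p.2 ≤ g (Function.update p.2 i (p.1 i))) :
    ∀ᵐ p ∂((Measure.pi fun _ : ι => ℓ).prod (Measure.pi fun _ : ι => ℓ)),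
      (∀ i, p.2 i < p.1 i) → g p.2 ≤ g p.1 := by
  have key : ∀ s : Finset ι,
      ∀ᵐ p ∂((Measure.pi fun _ : ι => ℓ).prod (Measure.pi fun _ : ι => ℓ)),
        (∀ i, p.2 i < p.1 i) → g p.2 ≤ g (s.piecewise p.1 p.2) := by
    intro s
    induction s using Finset.induction_on with
    | empty => exact Filter.Eventually.of_forall fun p _ => by simp
    | insert i s hi ih =>
      filter_upwards [ih,
        (measurePreserving_piecewise_swap ℓ s).quasiMeasurePreserving.ae (h i)] with p hp hp' hlt
      refine (hp hlt).trans ?_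
      simp only [Finset.piecewise_eq_of_notMem _ _ _ hi] at hp'
      rw [Finset.piecewise_insert]
      exact hp' (hlt i)
  filter_upwards [key Finset.univ] with p hp hlt
  simpa using hp hlt

/-- The points below which, strictly in each coordinate, `g` exceeds `s` on a nonnull set. -/
def essSuperlevel (μ : Measure (ι → ℝ)) (g : (ι → ℝ) → ℝ) (s : ℝ) : Set (ι → ℝ) :=
  {x | 0 < μ {y | (∀ i, y i < x i) ∧ s < g y}}

end Monotone

section EssSuperlevel

variable {ι : Type*} {μ : Measure (ι → ℝ)} {g : (ι → ℝ) → ℝ}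

theorem isUpperSet_essSuperlevel (s : ℝ) : IsUpperSet (essSuperlevel μ g s) := by
  intro x y hxy hx
  refine lt_of_lt_of_le hx (measure_mono ?_)
  rintro z ⟨hz, hs⟩
  exact ⟨fun i => (hz i).trans_le (hxy i), hs⟩

theorem antitone_essSuperlevel : Antitone (essSuperlevel μ g) := by
  intro s t hst x hx
  refine lt_of_lt_of_le hx (measure_mono ?_)
  rintro z ⟨hz, ht⟩
  exact ⟨hz, hst.trans_lt ht⟩

theorem isOpen_essSuperlevel [Finite ι] :
    IsOpen {p : ℝ × (ι → ℝ) | p.2 ∈ essSuperlevel μ g p.1} := by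
  rw [isOpen_iff_forall_mem_open]
  rintro ⟨s, x⟩ hp
  set W : ℕ → Set (ι → ℝ) := fun k =>
    {y | (∀ i, y i < x i - 1 / ((k : ℝ) + 1)) ∧ s + 1 / ((k : ℝ) + 1) < g y} with hW
  have hcov : {y | (∀ i, y i < x i) ∧ s < g y} ⊆ ⋃ k, W k := by
    rintro y ⟨hy, hs⟩
    have hl : Filter.Tendsto (fun k : ℕ => 1 / ((k : ℝ) + 1)) Filter.atTop (nhds 0) :=
      tendsto_one_div_add_atTop_nhds_zero_nat
    have h1 : ∀ᶠ k : ℕ in Filter.atTop, ∀ i, 1 / ((k : ℝ) + 1) < x i - y i :=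
      Filter.eventually_all.2 fun i => hl.eventually_lt_const (sub_pos.2 (hy i))
    have h2 : ∀ᶠ k : ℕ in Filter.atTop, 1 / ((k : ℝ) + 1) < g y - s :=
      hl.eventually_lt_const (sub_pos.2 hs)
    obtain ⟨k, hk1, hk2⟩ := (h1.and h2).exists
    exact Set.mem_iUnion.2 ⟨k, fun i => by linarith [hk1 i], by linarith⟩
  obtain ⟨k, hk⟩ : ∃ k, 0 < μ (W k) := by
    by_contra! hall
    exact (ne_of_gt hp) (measure_mono_null hcov
      (measure_iUnion_null fun k => le_antisymm (hall k) bot_le))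
  have hpos : 0 < 1 / ((k : ℝ) + 1) := Nat.one_div_pos_of_nat
  refine ⟨{p | p.1 < s + 1 / ((k : ℝ) + 1)} ∩ ⋂ i, {p | x i - 1 / ((k : ℝ) + 1) < p.2 i},
    ?_, ?_, ?_, ?_⟩
  · rintro ⟨s', x'⟩ ⟨h1, h2⟩
    rw [Set.mem_iInter] at h2
    refine lt_of_lt_of_le hk (measure_mono ?_)
    rintro y ⟨hy, hs⟩
    exact ⟨fun i => (hy i).trans (h2 i), lt_trans h1 hs⟩
  · refine (isOpen_lt (by fun_prop) (by fun_prop)).inter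
      (isOpen_iInter_of_finite fun i => isOpen_lt (by fun_prop) (by fun_prop))
  · simpa using hpos
  · simp only [Set.mem_iInter, Set.mem_ofPred_eq]
    exact fun i => by linarith

theorem ae_mem_essSuperlevel_iff [Fintype ι] [SFinite μ] (hμ : μ ≪ volume)
    (hmono : ∀ᵐ p ∂(μ.prod μ), (∀ i, p.2 i < p.1 i) → g p.2 ≤ g p.1) (s : ℝ) :
    ∀ᵐ x ∂μ, (x ∈ essSuperlevel μ g s ↔ s < g x) := by
  set N : Set (ι → ℝ) := {x | s < g x ∧ x ∉ essSuperlevel μ g s} with hN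
  set V : Set (ι → ℝ) := ⋃ x ∈ N, {y | ∀ i, y i < x i} with hV
  have hNnull : ∀ x ∈ N, μ (N ∩ {y | ∀ i, y i < x i}) = 0 := by
    rintro x ⟨-, hx⟩
    have : μ {y | (∀ i, y i < x i) ∧ s < g y} = 0 := by
      simpa [essSuperlevel] using hx
    refine measure_mono_null ?_ this
    rintro y ⟨⟨hy, -⟩, hyx⟩
    exact ⟨hyx, hy⟩
  have h1 : μ (N ∩ V) = 0 := by
    refine measure_null_of_locally_null _ fun z hz => ?_
    obtain ⟨hzN, hzV⟩ := hz
    obtain ⟨x, hx, hzx⟩ := Set.mem_iUnion₂.1 hzV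
    refine ⟨N ∩ {y | ∀ i, y i < x i}, ?_, hNnull x hx⟩
    have ho : IsOpen {y : ι → ℝ | ∀ i, y i < x i} := by
      rw [Set.ofPred_forall]
      exact isOpen_iInter_of_finite fun i => isOpen_lt (by fun_prop) (by fun_prop)
    filter_upwards [self_mem_nhdsWithin, mem_nhdsWithin_of_mem_nhds (ho.mem_nhds hzx)]
      with y hy hy' using ⟨hy.1, hy'⟩
  have hVl : IsLowerSet V := by
    refine isLowerSet_iUnion₂ fun x _ => fun y z hzy hy i => (hzy i).trans_lt (hy i)
  have h2 : μ (N \ V) = 0 := by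
    refine measure_mono_null ?_ (hμ hVl.null_frontier)
    rintro z ⟨hzN, hzV⟩
    refine ⟨?_, fun h => hzV (interior_subset h)⟩
    have hl : Filter.Tendsto (fun k : ℕ => fun i => z i - 1 / ((k : ℝ) + 1)) Filter.atTop
        (nhds z) := by
      rw [tendsto_pi_nhds]
      intro i
      simpa using tendsto_const_nhds.sub (tendsto_one_div_add_atTop_nhds_zero_nat (𝕜 := ℝ))
    refine mem_closure_of_tendsto hl (Filter.Eventually.of_forall fun k =>
      Set.mem_iUnion₂.2 ⟨z, hzN, fun i => ?_⟩)
    have : 0 < 1 / ((k : ℝ) + 1) := Nat.one_div_pos_of_nat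
    linarith
  have h3 : ∀ᵐ x ∂μ, x ∉ N := by
    refine measure_eq_zero_iff_ae_notMem.1 ?_
    rw [← Set.inter_union_sdiff N V]
    exact measure_union_null h1 h2
  filter_upwards [h3, Measure.ae_ae_of_ae_prod hmono] with x hx hx'
  refine ⟨fun hU => ?_, fun hs => by_contra fun hU => hx ⟨hs, hU⟩⟩
  by_contra hs
  refine (ne_of_gt hU) (measure_mono_null (fun y hy => ?_) (ae_iff.1 hx'))
  simp only [Set.mem_ofPred_eq, not_forall, not_le]
  exact ⟨hy.1, lt_of_le_of_lt (not_lt.1 hs) hy.2⟩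

end EssSuperlevel

theorem measurable_indicator_section {ι : Type*} [Fintype ι] {U : ℝ → Set (ι → ℝ)}
    (hU : IsOpen {p : ℝ × (ι → ℝ) | p.2 ∈ U p.1}) :
    Measurable fun p : ℝ × (ι → ℝ) => (U p.1).indicator (fun _ => (1 : ℝ)) p.2 :=
  (measurable_const (a := (1 : ℝ))).indicator hU.measurableSet

theorem abs_indicator_one_le {α : Type*} (A : Set α) (x : α) :
    |A.indicator (fun _ => (1 : ℝ)) x| ≤ 1 := by
  by_cases h : x ∈ A <;> simp [h]

section SectionMass

variable {ι : Type*} [Fintype ι] [DecidableEq ι]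

/-- The mass of the section of `U s` at height `t` in the `i`-th coordinate. -/
def sectionMass (ℓ : Measure ℝ) (U : ℝ → Set (ι → ℝ)) (i : ι) (s t : ℝ) : ℝ :=
  ∫ x, (U s).indicator (fun _ => (1 : ℝ)) (Function.update x i t) ∂(Measure.pi fun _ => ℓ)

variable {ℓ : Measure ℝ} [IsProbabilityMeasure ℓ] {U : ℝ → Set (ι → ℝ)}

theorem integrable_indicator_update (hU : IsOpen {p : ℝ × (ι → ℝ) | p.2 ∈ U p.1}) (i : ι)
    (s t : ℝ) : Integrable (fun x : ι → ℝ =>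
      (U s).indicator (fun _ => (1 : ℝ)) (Function.update x i t)) (Measure.pi fun _ => ℓ) := by
  refine integrable_of_measurable_of_abs_le ?_ 1 fun x => abs_indicator_one_le _ _
  exact ((measurable_indicator_section hU).comp measurable_prodMk_left).comp
    ((measurable_update_prod i).comp (measurable_const.prodMk measurable_id))

theorem sectionMass_mem_Icc (i : ι) (s t : ℝ) : sectionMass ℓ U i s t ∈ Set.Icc (0 : ℝ) 1 := by
  refine ⟨integral_nonneg fun x => Set.indicator_nonneg (fun _ _ => zero_le_one) _, ?_⟩
  refine (le_abs_self _).trans ?_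
  simpa [sectionMass] using norm_integral_le_of_norm_le_const (μ := Measure.pi fun _ : ι => ℓ) (C := 1)
    (f := fun x => (U s).indicator (fun _ => (1 : ℝ)) (Function.update x i t))
    (Filter.Eventually.of_forall fun x => abs_indicator_one_le _ _)

theorem abs_sectionMass_le (i : ι) (s t : ℝ) : |sectionMass ℓ U i s t| ≤ 1 := by
  have := sectionMass_mem_Icc (ℓ := ℓ) (U := U) i s t
  rw [abs_of_nonneg this.1]
  exact this.2

theorem measurable_sectionMass (hU : IsOpen {p : ℝ × (ι → ℝ) | p.2 ∈ U p.1}) (i : ι) :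
    Measurable fun p : ℝ × ℝ => sectionMass ℓ U i p.1 p.2 := by
  refine (StronglyMeasurable.integral_prod_right (f := fun (p : ℝ × ℝ) (x : ι → ℝ) =>
    (U p.1).indicator (fun _ => (1 : ℝ)) (Function.update x i p.2))
    (Measurable.stronglyMeasurable ?_)).measurable
  have h : Measurable fun w : (ℝ × ℝ) × (ι → ℝ) => (w.1.1, Function.update w.2 i w.1.2) :=
    (by fun_prop : Measurable fun w : (ℝ × ℝ) × (ι → ℝ) => w.1.1).prodMk
      ((measurable_update_prod i).comp
        (by fun_prop : Measurable fun w : (ℝ × ℝ) × (ι → ℝ) => (w.1.2, w.2)))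
  exact (measurable_indicator_section hU).comp h

theorem measurable_sectionMass_left (hU : IsOpen {p : ℝ × (ι → ℝ) | p.2 ∈ U p.1}) (i : ι)
    (t : ℝ) : Measurable fun s => sectionMass ℓ U i s t :=
  (measurable_sectionMass hU i).comp measurable_prodMk_right

theorem monotone_sectionMass (hU : IsOpen {p : ℝ × (ι → ℝ) | p.2 ∈ U p.1})
    (hup : ∀ s, IsUpperSet (U s)) (i : ι) (s : ℝ) : Monotone (sectionMass ℓ U i s) := by
  intro t t' htt
  refine integral_mono (integrable_indicator_update hU i s t)
    (integrable_indicator_update hU i s t') fun x => ?_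
  have hle : Function.update x i t ≤ Function.update x i t' :=
    update_le_update_iff.2 ⟨htt, fun _ _ => le_rfl⟩
  by_cases h : Function.update x i t ∈ U s
  · simp [h, hup s hle h]
  · simp only [Set.indicator_of_notMem h]
    exact Set.indicator_nonneg (fun _ _ => zero_le_one) _

theorem tendsto_sectionMass (hU : IsOpen {p : ℝ × (ι → ℝ) | p.2 ∈ U p.1})
    (hup : ∀ s, IsUpperSet (U s)) (i : ι) (s t : ℝ) :
    Filter.Tendsto (sectionMass ℓ U i s) (nhdsWithin t (Set.Iio t))
      (nhds (sectionMass ℓ U i s t)) := by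
  refine tendsto_integral_filter_of_dominated_convergence (fun _ => 1)
    (Filter.Eventually.of_forall fun t' =>
      (integrable_indicator_update hU i s t').aestronglyMeasurable)
    (Filter.Eventually.of_forall fun t' => Filter.Eventually.of_forall fun x =>
      abs_indicator_one_le _ _) (integrable_const _) (Filter.Eventually.of_forall fun x => ?_)
  refine tendsto_const_nhds.congr' ?_
  by_cases h : Function.update x i t ∈ U s
  · have ho : IsOpen {t' | Function.update x i t' ∈ U s} :=
      hU.preimage (by fun_prop : Continuous fun t' : ℝ => (s, Function.update x i t'))
    filter_upwards [mem_nhdsWithin_of_mem_nhds (ho.mem_nhds h)] with t' ht'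
    rw [Set.indicator_of_mem h, Set.indicator_of_mem ht']
  · filter_upwards [self_mem_nhdsWithin] with t' ht'
    rw [Set.indicator_of_notMem h, Set.indicator_of_notMem fun h' => h (hup s ?_ h')]
    exact update_le_update_iff.2 ⟨le_of_lt ht', fun _ _ => le_rfl⟩

theorem integrable_mul_sectionMass (hU : IsOpen {p : ℝ × (ι → ℝ) | p.2 ∈ U p.1}) (i : ι) (t : ℝ)
    {w : ℝ → ℝ} (hw : Measurable w) {C : ℝ} (hwC : ∀ s, |w s| ≤ C) {ν : Measure ℝ}
    [IsFiniteMeasure ν] : Integrable (fun s => w s * sectionMass ℓ U i s t) ν := by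
  refine integrable_of_measurable_of_abs_le (hw.mul (measurable_sectionMass_left hU i t)) C
    fun s => ?_
  rw [abs_mul]
  exact (mul_le_of_le_one_right (abs_nonneg _) (abs_sectionMass_le i s t)).trans (hwC s)

theorem tendsto_integral_mul_sectionMass (hU : IsOpen {p : ℝ × (ι → ℝ) | p.2 ∈ U p.1})
    (hup : ∀ s, IsUpperSet (U s)) (i : ι) {w : ℝ → ℝ} (hw : Measurable w) {C : ℝ}
    (hwC : ∀ s, |w s| ≤ C) (ν : Measure ℝ) [IsFiniteMeasure ν] (t : ℝ) :
    Filter.Tendsto (fun t => ∫ s, w s * sectionMass ℓ U i s t ∂ν) (nhdsWithin t (Set.Iio t))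
      (nhds (∫ s, w s * sectionMass ℓ U i s t ∂ν)) := by
  refine tendsto_integral_filter_of_dominated_convergence (fun _ => C)
    (Filter.Eventually.of_forall fun t' =>
      (integrable_mul_sectionMass hU i t' hw hwC).aestronglyMeasurable)
    (Filter.Eventually.of_forall fun t' => Filter.Eventually.of_forall fun s => ?_)
    (integrable_const _)
    (Filter.Eventually.of_forall fun s => (tendsto_sectionMass hU hup i s t).const_mul _)
  rw [Real.norm_eq_abs, abs_mul]
  exact (mul_le_of_le_one_right (abs_nonneg _) (abs_sectionMass_le i s t')).trans (hwC s)

theorem integral_integral_indicator_update (hU : IsOpen {p : ℝ × (ι → ℝ) | p.2 ∈ U p.1}) (i : ι)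
    (t : ℝ) {w : ℝ → ℝ} (hw : Measurable w) {C : ℝ} (hwC : ∀ s, |w s| ≤ C) (ν : Measure ℝ)
    [IsFiniteMeasure ν] :
    ∫ x, ∫ s, w s * (U s).indicator (fun _ => (1 : ℝ)) (Function.update x i t) ∂ν
      ∂(Measure.pi fun _ => ℓ) = ∫ s, w s * sectionMass ℓ U i s t ∂ν := by
  rw [integral_integral_swap]
  · simp only [integral_const_mul, sectionMass]
  · refine integrable_of_measurable_of_abs_le ((hw.comp measurable_snd).mul ?_) C fun p => ?_
    · exact (measurable_indicator_section hU).comp (measurable_snd.prodMk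
        ((measurable_update_prod i).comp (measurable_const.prodMk measurable_fst)))
    · simp only [Function.uncurry, abs_mul]
      exact (mul_le_of_le_one_right (abs_nonneg _) (abs_indicator_one_le _ _)).trans (hwC _)

end SectionMass

section UnitInterval

/-- The uniform distribution on the unit interval. -/
abbrev unitLaw : Measure ℝ := volume.restrict (Set.Icc 0 1)

instance isProbabilityMeasure_unitLaw : IsProbabilityMeasure unitLaw :=
  ⟨by simp [unitLaw]⟩

theorem volume_restrict_cube (n : ℕ) :
    volume.restrict (cube n) = Measure.pi fun _ : Fin n => unitLaw := by
  rw [cube, ← Set.pi_univ_Icc, volume_pi, Measure.restrict_pi_pi]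
  rfl

theorem ae_mem_Ioc_unitLaw : ∀ᵐ t ∂unitLaw, t ∈ Set.Ioc (0 : ℝ) 1 := by
  rw [unitLaw, ← Measure.restrict_congr_set (Ioc_ae_eq_Icc (μ := volume) (a := (0 : ℝ)) (b := 1))]
  exact ae_restrict_mem measurableSet_Ioc

theorem integral_indicator_lt {c : ℝ} (hc : c ∈ Set.Icc (0 : ℝ) 1) :
    ∫ s, (if s < c then (1 : ℝ) else 0) ∂unitLaw = c := by
  have : (fun s => if s < c then (1 : ℝ) else 0) = (Set.Iio c).indicator 1 := by
    ext s; simp [Set.indicator]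
  rw [this, integral_indicator_one measurableSet_Iio, measureReal_def,
    Measure.restrict_apply measurableSet_Iio]
  have : Set.Iio c ∩ Set.Icc 0 1 = Set.Ico 0 c := by
    ext s
    simp only [Set.mem_inter_iff, Set.mem_Iio, Set.mem_Icc, Set.mem_Ico]
    exact ⟨fun h => ⟨h.2.1, h.1⟩, fun h => ⟨h.2, h.1, h.2.le.trans hc.2⟩⟩
  rw [this]
  simp [hc.1]

theorem eqOn_Ioc_of_ae {F G : ℝ → ℝ}
    (hF : ∀ t ∈ Set.Ioc (0 : ℝ) 1, Filter.Tendsto F (nhdsWithin t (Set.Iio t)) (nhds (F t)))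
    (hG : ∀ t ∈ Set.Ioc (0 : ℝ) 1, Filter.Tendsto G (nhdsWithin t (Set.Iio t)) (nhds (G t)))
    (h : ∀ᵐ t ∂unitLaw, F t = G t) : ∀ t ∈ Set.Ioc (0 : ℝ) 1, F t = G t := by
  refine eqOn_Ioc_of_leftContinuous_of_dense (D := {t | t ∈ Set.Icc (0 : ℝ) 1 → F t = G t})
    ?_ hF hG fun t ht ht' => ht ⟨ht'.1.le, ht'.2⟩
  exact Measure.dense_of_ae ((ae_restrict_iff' measurableSet_Icc).1 h)

theorem MonoLC.integrable {q : ℝ → ℝ} (hq : MonoLC q) : Integrable q unitLaw :=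
  hq.1.integrableOn_isCompact isCompact_Icc

/-- Every rationalizable tuple is rationalized by a uniform mixture of a decreasing family of open
up-sets. -/
theorem exists_upSet_family {n : ℕ} {q : Fin n → ℝ → ℝ} (hq : q ∈ QsetN n) :
    ∃ U : ℝ → Set (Fin n → ℝ), (∀ s, IsUpperSet (U s)) ∧ Antitone U ∧
      IsOpen {p : ℝ × (Fin n → ℝ) | p.2 ∈ U p.1} ∧
      ∀ i, ∀ t ∈ Set.Ioc (0 : ℝ) 1, q i t = ∫ s, sectionMass unitLaw U i s t ∂unitLaw := by
  obtain ⟨hLC, f, hf, hf01, hfq⟩ := hq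
  rw [volume_restrict_cube] at hf
  simp only [volume_restrict_cube] at hfq
  have hmem : ∀ᵐ x ∂(Measure.pi fun _ : Fin n => unitLaw), x ∈ cube n := by
    rw [← volume_restrict_cube]
    exact ae_restrict_mem measurableSet_Icc
  have hIcc : ∀ᵐ t ∂unitLaw, t ∈ Set.Icc (0 : ℝ) 1 := ae_restrict_mem measurableSet_Icc
  obtain ⟨g, hg, hg01, hgq, hgm⟩ := exists_ae_monotone_of_marginals unitLaw
    (fun i => (hLC i).integrable)
    (fun i => by
      filter_upwards [hIcc] with b hb
      filter_upwards [hIcc] with a ha hab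
      exact (hLC i).1 ha hb hab.le) hf (hmem.mono hf01) hfq
  have hac : (Measure.pi fun _ : Fin n => unitLaw) ≪ volume := by
    rw [← volume_restrict_cube]
    exact Measure.absolutelyContinuous_restrict
  set μ : Measure (Fin n → ℝ) := Measure.pi fun _ => unitLaw with hμ
  have hU : IsOpen {p : ℝ × (Fin n → ℝ) | p.2 ∈ essSuperlevel μ g p.1} :=
    isOpen_essSuperlevel
  refine ⟨essSuperlevel μ g, isUpperSet_essSuperlevel, antitone_essSuperlevel, hU, fun i => ?_⟩
  have hae := ae_mem_essSuperlevel_iff hac (ae_le_of_ae_monotone_coordinates unitLaw hgm)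
  have hgU : ∀ᵐ x ∂μ, g x =
      ∫ s, 1 * (essSuperlevel μ g s).indicator (fun _ => (1 : ℝ)) x ∂unitLaw := by
    have hmeas : MeasurableSet {p : ℝ × (Fin n → ℝ) | p.2 ∈ essSuperlevel μ g p.1 ↔ p.1 < g p.2} :=
      MeasurableSet.iff hU.measurableSet
        (measurableSet_lt measurable_fst (hg.comp measurable_snd))
    have := (Measure.ae_ae_comm (μ := unitLaw) (ν := μ) hmeas).1
      (Filter.Eventually.of_forall hae)
    filter_upwards [this] with x hx
    rw [← integral_indicator_lt (hg01 x)]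
    refine integral_congr_ae ?_
    filter_upwards [hx] with s hs
    by_cases h : s < g x
    · simp [h, hs.2 h]
    · simp [h, mt hs.1 h]
  have h1 : ∀ᵐ t ∂unitLaw, q i t = ∫ s, 1 * sectionMass unitLaw (essSuperlevel μ g) i s t
      ∂unitLaw := by
    filter_upwards [hgq i, ae_ae_update unitLaw i hgU] with t ht ht'
    rw [ht, ← integral_integral_indicator_update hU i t measurable_const (C := 1) (by simp)]
    exact integral_congr_ae ht'
  simpa only [one_mul] using eqOn_Ioc_of_ae (hLC i).2.2
    (fun t _ => tendsto_integral_mul_sectionMass hU isUpperSet_essSuperlevel i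
      measurable_const (C := 1) (by simp) unitLaw t) h1

end UnitInterval

theorem MonoLC.update_zero {F : ℝ → ℝ} {c : ℝ} (hF : MonotoneOn F (Set.Ioc 0 1))
    (hF1 : ∀ t ∈ Set.Ioc (0 : ℝ) 1, F t ≤ 1)
    (hFl : ∀ t ∈ Set.Ioc (0 : ℝ) 1, Filter.Tendsto F (nhdsWithin t (Set.Iio t)) (nhds (F t)))
    (hc : 0 ≤ c) (hcF : ∀ t ∈ Set.Ioc (0 : ℝ) 1, c ≤ F t) : MonoLC (Function.update F 0 c) := by
  have h1 : (1 : ℝ) ∈ Set.Ioc (0 : ℝ) 1 := by simp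
  have hne : ∀ t ∈ Set.Ioc (0 : ℝ) 1, Function.update F 0 c t = F t := fun t ht =>
    Function.update_of_ne ht.1.ne' _ _
  have hcases : ∀ t ∈ Set.Icc (0 : ℝ) 1, t = 0 ∨ t ∈ Set.Ioc (0 : ℝ) 1 := fun t ht =>
    ht.1.eq_or_lt.imp Eq.symm fun h => ⟨h, ht.2⟩
  refine ⟨fun a ha b hb hab => ?_, fun t ht => ?_, fun t ht => ?_⟩
  · rcases hcases a ha with rfl | ha
    · rcases hcases b hb with rfl | hb
      · exact le_rfl
      · rw [hne b hb, Function.update_self]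
        exact hcF b hb
    · have hb : b ∈ Set.Ioc (0 : ℝ) 1 := ⟨ha.1.trans_le hab, hb.2⟩
      rw [hne a ha, hne b hb]
      exact hF ha hb hab
  · rcases hcases t ht with rfl | ht
    · rw [Function.update_self]
      exact ⟨hc, (hcF 1 h1).trans (hF1 1 h1)⟩
    · rw [hne t ht]
      exact ⟨hc.trans (hcF t ht), hF1 t ht⟩
  · rw [hne t ht]
    refine (hFl t ht).congr' ?_
    filter_upwards [self_mem_nhdsWithin, mem_nhdsWithin_of_mem_nhds (Ioi_mem_nhds ht.1)] with a h h'
    exact (hne a ⟨h', (le_of_lt h).trans ht.2⟩).symm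

/-- A splitting of `q` into two functions on `(0, 1]` extends to `[0, 1]`. -/
theorem MonoLC.exists_split {q F G : ℝ → ℝ} (hq : MonoLC q) (hF : MonotoneOn F (Set.Ioc 0 1))
    (hG : MonotoneOn G (Set.Ioc 0 1)) (hF01 : ∀ t ∈ Set.Ioc (0 : ℝ) 1, F t ∈ Set.Icc (0 : ℝ) 1)
    (hG01 : ∀ t ∈ Set.Ioc (0 : ℝ) 1, G t ∈ Set.Icc (0 : ℝ) 1)
    (hFl : ∀ t ∈ Set.Ioc (0 : ℝ) 1, Filter.Tendsto F (nhdsWithin t (Set.Iio t)) (nhds (F t)))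
    (hGl : ∀ t ∈ Set.Ioc (0 : ℝ) 1, Filter.Tendsto G (nhdsWithin t (Set.Iio t)) (nhds (G t)))
    (h : ∀ t ∈ Set.Ioc (0 : ℝ) 1, 2 * q t = F t + G t) :
    ∃ F' G' : ℝ → ℝ, MonoLC F' ∧ MonoLC G' ∧ (∀ t ∈ Set.Ioc (0 : ℝ) 1, F' t = F t) ∧
      (∀ t ∈ Set.Ioc (0 : ℝ) 1, G' t = G t) ∧
      ∀ t ∈ Set.Icc (0 : ℝ) 1, q t = 1 / 2 * F' t + (1 - 1 / 2) * G' t := by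
  have h1 : (1 : ℝ) ∈ Set.Ioc (0 : ℝ) 1 := by simp
  have h0 : (0 : ℝ) ∈ Set.Icc (0 : ℝ) 1 := by simp
  have hq0 := (hq.2.1 0 h0).1
  set L := sInf (F '' Set.Ioc 0 1) with hL
  have hbdd : BddBelow (F '' Set.Ioc 0 1) := ⟨0, by rintro _ ⟨t, ht, rfl⟩; exact (hF01 t ht).1⟩
  have hne : (F '' Set.Ioc 0 1).Nonempty := ⟨_, 1, h1, rfl⟩
  have hL0 : 0 ≤ L := le_csInf hne (by rintro _ ⟨t, ht, rfl⟩; exact (hF01 t ht).1)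
  have hLF : ∀ t ∈ Set.Ioc (0 : ℝ) 1, L ≤ F t := fun t ht => csInf_le hbdd ⟨t, ht, rfl⟩
  have hLG : ∀ t ∈ Set.Ioc (0 : ℝ) 1, 2 * q 0 - G t ≤ L := by
    intro t ht
    refine le_csInf hne ?_
    rintro _ ⟨t', ht', rfl⟩
    have hm : min t t' ∈ Set.Ioc (0 : ℝ) 1 := ⟨lt_min ht.1 ht'.1, (min_le_left _ _).trans ht.2⟩
    have e1 := hF hm ht' (min_le_right _ _)
    have e2 := hG hm ht (min_le_left _ _)
    have e3 := hq.1 h0 ⟨hm.1.le, hm.2⟩ hm.1.le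
    linarith [h _ hm]
  have hu : ∀ (H : ℝ → ℝ) c, ∀ t ∈ Set.Ioc (0 : ℝ) 1, Function.update H 0 c t = H t :=
    fun H c t ht => Function.update_of_ne ht.1.ne' _ _
  refine ⟨Function.update F 0 (min L (2 * q 0)), Function.update G 0 (2 * q 0 - min L (2 * q 0)),
    MonoLC.update_zero hF (fun t ht => (hF01 t ht).2) hFl (le_min hL0 (by linarith))
      fun t ht => (min_le_left _ _).trans (hLF t ht),
    MonoLC.update_zero hG (fun t ht => (hG01 t ht).2) hGl (sub_nonneg.2 (min_le_right _ _))
      fun t ht => ?_, hu _ _, hu _ _, fun t ht => ?_⟩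
  · rcases min_cases L (2 * q 0) with ⟨e, -⟩ | ⟨e, -⟩ <;> rw [e]
    · linarith [hLG t ht]
    · linarith [(hG01 t ht).1]
  · rcases ht.1.eq_or_lt with rfl | h'
    · simp only [Function.update_self]
      ring
    · have ht' : t ∈ Set.Ioc (0 : ℝ) 1 := ⟨h', ht.2⟩
      rw [hu _ _ t ht', hu _ _ t ht']
      linarith [h t ht']

section Weighted

variable {n : ℕ} {U : ℝ → Set (Fin n → ℝ)}

theorem mem_QsetN_of_weight (hU : IsOpen {p : ℝ × (Fin n → ℝ) | p.2 ∈ U p.1}) {w : ℝ → ℝ}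
    (hw : Measurable w) (hw0 : ∀ s, 0 ≤ w s) {C : ℝ} (hwC : ∀ s, |w s| ≤ C)
    (hw1 : ∫ s, w s ∂unitLaw = 1) {p : Fin n → ℝ → ℝ} (hp : ∀ i, MonoLC (p i))
    (hpw : ∀ i, ∀ t ∈ Set.Ioc (0 : ℝ) 1,
      p i t = ∫ s, w s * sectionMass unitLaw U i s t ∂unitLaw) : p ∈ QsetN n := by
  refine ⟨hp, fun x => ∫ s, w s * (U s).indicator (fun _ => (1 : ℝ)) x ∂unitLaw, ?_,
    fun x _ => ⟨?_, ?_⟩, fun i => ?_⟩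
  · refine (StronglyMeasurable.integral_prod_right (f := fun (x : Fin n → ℝ) s =>
      w s * (U s).indicator (fun _ => (1 : ℝ)) x)
      (Measurable.stronglyMeasurable ?_)).measurable.aemeasurable
    exact (hw.comp measurable_snd).mul ((measurable_indicator_section hU).comp measurable_swap)
  · exact integral_nonneg fun s =>
      mul_nonneg (hw0 s) (Set.indicator_nonneg (fun _ _ => zero_le_one) _)
  · refine le_of_le_of_eq ?_ hw1
    refine integral_mono_of_nonneg (Filter.Eventually.of_forall fun s =>
      mul_nonneg (hw0 s) (Set.indicator_nonneg (fun _ _ => zero_le_one) _))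
      (integrable_of_measurable_of_abs_le hw C hwC) (Filter.Eventually.of_forall fun s => ?_)
    exact mul_le_of_le_one_right (hw0 s) ((le_abs_self _).trans (abs_indicator_one_le _ _))
  · rw [volume_restrict_cube]
    filter_upwards [ae_mem_Ioc_unitLaw] with t ht
    rw [hpw i t ht, integral_integral_indicator_update hU i t hw hwC]

theorem integral_weight_mem_Icc (hU : IsOpen {p : ℝ × (Fin n → ℝ) | p.2 ∈ U p.1}) {w : ℝ → ℝ}
    (hw : Measurable w) (hw0 : ∀ s, 0 ≤ w s) {C : ℝ} (hwC : ∀ s, |w s| ≤ C)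
    (hw1 : ∫ s, w s ∂unitLaw = 1) (i : Fin n) (t : ℝ) :
    ∫ s, w s * sectionMass unitLaw U i s t ∂unitLaw ∈ Set.Icc (0 : ℝ) 1 := by
  refine ⟨integral_nonneg fun s => mul_nonneg (hw0 s) (sectionMass_mem_Icc i s t).1, ?_⟩
  conv_rhs => rw [← hw1]
  exact integral_mono (integrable_mul_sectionMass hU i t hw hwC)
    (integrable_of_measurable_of_abs_le hw C hwC)
    fun s => mul_le_of_le_one_right (hw0 s) (sectionMass_mem_Icc i s t).2

theorem monotone_integral_weight (hU : IsOpen {p : ℝ × (Fin n → ℝ) | p.2 ∈ U p.1})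
    (hup : ∀ s, IsUpperSet (U s)) {w : ℝ → ℝ} (hw : Measurable w) (hw0 : ∀ s, 0 ≤ w s) {C : ℝ}
    (hwC : ∀ s, |w s| ≤ C) (i : Fin n) :
    Monotone fun t => ∫ s, w s * sectionMass unitLaw U i s t ∂unitLaw := fun t t' htt =>
  integral_mono (integrable_mul_sectionMass hU i t hw hwC)
    (integrable_mul_sectionMass hU i t' hw hwC)
    fun s => mul_le_mul_of_nonneg_left (monotone_sectionMass hU hup i s htt) (hw0 s)

/-- The value of the linear functional `φ` at the interim allocation induced by `U s`. -/
def sectionFunctional (U : ℝ → Set (Fin n → ℝ)) (φ : Fin n → ℝ → ℝ) (s : ℝ) : ℝ :=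
  ∑ i, ∫ t, sectionMass unitLaw U i s t * φ i t ∂unitLaw

variable {φ : Fin n → ℝ → ℝ}

theorem measurable_sectionFunctional (hU : IsOpen {p : ℝ × (Fin n → ℝ) | p.2 ∈ U p.1})
    (hφ : ∀ i, Measurable (φ i)) : Measurable (sectionFunctional U φ) := by
  refine Finset.measurable_sum _ fun i _ => ?_
  exact (StronglyMeasurable.integral_prod_right (f := fun s t =>
    sectionMass unitLaw U i s t * φ i t)
    ((measurable_sectionMass hU i).mul
      ((hφ i).comp measurable_snd)).stronglyMeasurable).measurable

theorem exists_abs_sectionFunctional_le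
    (hφb : ∀ i, ∃ C : ℝ, ∀ᵐ t ∂unitLaw, |φ i t| ≤ C) :
    ∃ M, ∀ s, |sectionFunctional U φ s| ≤ M := by
  choose C hC using hφb
  refine ⟨∑ i, C i, fun s => (Finset.abs_sum_le_sum_abs _ _).trans
    (Finset.sum_le_sum fun i _ => ?_)⟩
  simpa using norm_integral_le_of_norm_le_const (μ := unitLaw) (C := C i)
    (f := fun t => sectionMass unitLaw U i s t * φ i t) (by
      filter_upwards [hC i] with t ht
      rw [Real.norm_eq_abs, abs_mul]
      exact (mul_le_of_le_one_left (abs_nonneg _) (abs_sectionMass_le i s t)).trans ht)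

theorem sum_integral_weight_mul (hU : IsOpen {p : ℝ × (Fin n → ℝ) | p.2 ∈ U p.1})
    (hφ : ∀ i, Measurable (φ i)) (hφb : ∀ i, ∃ C : ℝ, ∀ᵐ t ∂unitLaw, |φ i t| ≤ C)
    {w : ℝ → ℝ} (hw : Measurable w) {C : ℝ} (hwC : ∀ s, |w s| ≤ C) {p : Fin n → ℝ → ℝ}
    (hpw : ∀ i, ∀ t ∈ Set.Ioc (0 : ℝ) 1,
      p i t = ∫ s, w s * sectionMass unitLaw U i s t ∂unitLaw) :
    ∑ i, ∫ t, p i t * φ i t ∂unitLaw = ∫ s, w s * sectionFunctional U φ s ∂unitLaw := by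
  have hint : ∀ i, Integrable (fun z : ℝ × ℝ =>
      w z.1 * (sectionMass unitLaw U i z.1 z.2 * φ i z.2)) (unitLaw.prod unitLaw) := by
    intro i
    obtain ⟨K, hK⟩ := hφb i
    have hφI : Integrable (φ i) unitLaw := Integrable.of_bound (hφ i).aestronglyMeasurable K hK
    have hm : Measurable fun z : ℝ × ℝ => w z.1 * sectionMass unitLaw U i z.1 z.2 :=
      (hw.comp measurable_fst).mul (measurable_sectionMass hU i)
    have := (hφI.comp_snd unitLaw).bdd_mul (c := C) hm.aestronglyMeasurable
      (Filter.Eventually.of_forall fun z => by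
        rw [Real.norm_eq_abs, abs_mul]
        exact (mul_le_of_le_one_right (abs_nonneg _) (abs_sectionMass_le i _ _)).trans (hwC _))
    simpa only [mul_assoc] using this
  have hs : ∀ s, w s * sectionFunctional U φ s =
      ∑ i, ∫ t, w s * (sectionMass unitLaw U i s t * φ i t) ∂unitLaw := fun s => by
    simp only [sectionFunctional, Finset.mul_sum, integral_const_mul]
  simp only [hs]
  rw [integral_finsetSum _ fun i _ => (hint i).integral_prod_left]
  refine Finset.sum_congr rfl fun i _ => ?_
  rw [integral_integral_swap (hint i)]
  refine integral_congr_ae ?_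
  filter_upwards [ae_mem_Ioc_unitLaw] with t ht
  rw [hpw i t ht, ← integral_mul_const]
  simp only [mul_assoc]

end Weighted

/-- Signed reweightings of the family `U` which preserve the total mass and the constraints do not
move an extreme point. -/
theorem integral_mul_sectionMass_eq_zero_of_extreme {n m : ℕ} {U : ℝ → Set (Fin n → ℝ)}
    (hup : ∀ s, IsUpperSet (U s)) (hU : IsOpen {p : ℝ × (Fin n → ℝ) | p.2 ∈ U p.1})
    {ψ : Fin m → Fin n → ℝ → ℝ} (hψ : ∀ j i, Measurable (ψ j i))
    (hψb : ∀ j i, ∃ C : ℝ, ∀ᵐ t ∂unitLaw, |ψ j i t| ≤ C) {η : Fin m → ℝ} {q : Fin n → ℝ → ℝ}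
    (hq : ExtremePtQN n
      {p | p ∈ QsetN n ∧ ∀ j, (∑ i, ∫ t, p i t * ψ j i t ∂unitLaw) ≤ η j} q)
    (hqU : ∀ i, ∀ t ∈ Set.Ioc (0 : ℝ) 1, q i t = ∫ s, sectionMass unitLaw U i s t ∂unitLaw)
    {h : ℝ → ℝ} (hh : Measurable h) (hh1 : ∀ s, |h s| ≤ 1) (hh0 : ∫ s, h s ∂unitLaw = 0)
    (hhψ : ∀ j, ∫ s, h s * sectionFunctional U (ψ j) s ∂unitLaw = 0) (i : Fin n) {t : ℝ}
    (ht : t ∈ Set.Ioc (0 : ℝ) 1) : ∫ s, h s * sectionMass unitLaw U i s t ∂unitLaw = 0 := by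
  have hhI : Integrable h unitLaw := integrable_of_measurable_of_abs_le hh 1 hh1
  have hqU1 : ∀ i, ∀ t ∈ Set.Ioc (0 : ℝ) 1,
      q i t = ∫ s, 1 * sectionMass unitLaw U i s t ∂unitLaw := by simpa only [one_mul] using hqU
  have hadd : ∀ (ε : ℝ) i t, ∫ s, (1 + ε * h s) * sectionMass unitLaw U i s t ∂unitLaw =
      ∫ s, 1 * sectionMass unitLaw U i s t ∂unitLaw +
        ε * ∫ s, h s * sectionMass unitLaw U i s t ∂unitLaw := by
    intro ε i t
    rw [← integral_const_mul, ← integral_add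
      (integrable_mul_sectionMass hU i t measurable_const (C := 1) (by simp))
      ((integrable_mul_sectionMass hU i t hh hh1).const_mul ε)]
    congr 1
    ext s
    ring
  have hwm : ∀ ε : ℝ, Measurable fun s => 1 + ε * h s := fun ε => by fun_prop
  have hbd : ∀ ε : ℝ, |ε| = 1 → ∀ s, |ε * h s| ≤ 1 := fun ε hε s => by
    rw [abs_mul, hε, one_mul]; exact hh1 s
  have hw0 : ∀ ε : ℝ, |ε| = 1 → ∀ s, 0 ≤ 1 + ε * h s := fun ε hε s => by
    linarith [(abs_le.1 (hbd ε hε s)).1]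
  have hwC : ∀ ε : ℝ, |ε| = 1 → ∀ s, |1 + ε * h s| ≤ 2 := fun ε hε s => by
    rw [abs_of_nonneg (hw0 ε hε s)]; linarith [(abs_le.1 (hbd ε hε s)).2]
  have hw1 : ∀ ε : ℝ, ∫ s, (1 + ε * h s) ∂unitLaw = 1 := fun ε => by
    rw [integral_add (integrable_const _) (hhI.const_mul ε), integral_const_mul, hh0]
    simp
  have hψw : ∀ (ε : ℝ) j, ∫ s, (1 + ε * h s) * sectionFunctional U (ψ j) s ∂unitLaw =
      ∫ s, 1 * sectionFunctional U (ψ j) s ∂unitLaw := by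
    intro ε j
    have hm := measurable_sectionFunctional hU (hψ j)
    obtain ⟨M, hM⟩ := exists_abs_sectionFunctional_le (U := U) (hψb j)
    have hI : Integrable (sectionFunctional U (ψ j)) unitLaw :=
      integrable_of_measurable_of_abs_le hm M hM
    have hI' : Integrable (fun s => h s * sectionFunctional U (ψ j) s) unitLaw :=
      integrable_of_measurable_of_abs_le (hh.mul hm) M fun s => by
        rw [abs_mul]
        exact (mul_le_of_le_one_left (abs_nonneg _) (hh1 s)).trans (hM s)
    simp only [add_mul, one_mul, mul_assoc]
    rw [integral_add hI (hI'.const_mul ε), integral_const_mul, hhψ j, mul_zero, add_zero]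
  have hmem : ∀ (ε : ℝ), |ε| = 1 → ∀ p : Fin n → ℝ → ℝ, (∀ i, MonoLC (p i)) →
      (∀ i, ∀ t ∈ Set.Ioc (0 : ℝ) 1,
        p i t = ∫ s, (1 + ε * h s) * sectionMass unitLaw U i s t ∂unitLaw) →
      p ∈ {p | p ∈ QsetN n ∧ ∀ j, (∑ i, ∫ t, p i t * ψ j i t ∂unitLaw) ≤ η j} := by
    intro ε hε p hp hpw
    refine ⟨mem_QsetN_of_weight hU (hwm ε) (hw0 ε hε) (hwC ε hε) (hw1 ε) hp hpw, fun j => ?_⟩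
    rw [sum_integral_weight_mul hU (hψ j) (hψb j) (hwm ε) (hwC ε hε) hpw, hψw,
      ← sum_integral_weight_mul hU (hψ j) (hψb j) measurable_const (C := 1) (by simp) hqU1]
    exact hq.1.2 j
  have e1 : |(1 : ℝ)| = 1 := abs_one
  have e2 : |(-1 : ℝ)| = 1 := by simp
  have hsplit := fun i => MonoLC.exists_split (hq.1.1.1 i)
    ((monotone_integral_weight hU hup (hwm 1) (hw0 1 e1) (hwC 1 e1) i).monotoneOn _)
    ((monotone_integral_weight hU hup (hwm (-1)) (hw0 (-1) e2) (hwC (-1) e2) i).monotoneOn _)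
    (fun t _ => integral_weight_mem_Icc hU (hwm 1) (hw0 1 e1) (hwC 1 e1) (hw1 1) i t)
    (fun t _ => integral_weight_mem_Icc hU (hwm (-1)) (hw0 (-1) e2) (hwC (-1) e2) (hw1 (-1)) i t)
    (fun t _ => tendsto_integral_mul_sectionMass hU hup i (hwm 1) (hwC 1 e1) unitLaw t)
    (fun t _ => tendsto_integral_mul_sectionMass hU hup i (hwm (-1)) (hwC (-1) e2) unitLaw t)
    (fun t ht => by
      rw [hadd, hadd, ← hqU1 i t ht]
      ring)
  choose F G hF hG hFe hGe hFG using hsplit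
  have := hq.2 F (hmem 1 e1 F hF hFe) G (hmem (-1) e2 G hG hGe) (1 / 2) (by norm_num) (by norm_num)
    hFG i t ⟨ht.1.le, ht.2⟩
  rw [hFe i t ht, hGe i t ht, hadd, hadd] at this
  linarith

/-- Carathéodory's theorem for a curve in `ℝᵐ`, with ordered parameters. -/
theorem exists_antitone_of_mem_convexHull_image {m : ℕ} {c : ℝ → Fin m → ℝ} {S : Set ℝ}
    {x : Fin m → ℝ} (hx : x ∈ convexHull ℝ (c '' S)) :
    ∃ s lam : Fin (m + 1) → ℝ, Antitone s ∧ (∀ k, s k ∈ S) ∧ (∀ k, 0 ≤ lam k) ∧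
      ∑ k, lam k = 1 ∧ ∑ k, lam k • c (s k) = x := by
  obtain ⟨ι, _, z, w, hz, haff, hw, hw1, hwz⟩ := eq_pos_convex_span_of_mem_convexHull hx
  have hcard : Fintype.card ι ≤ Fintype.card (Fin (m + 1)) := by
    have h1 := haff.card_le_finrank_succ
    have h2 := Submodule.finrank_le (vectorSpan ℝ (Set.range z))
    simp only [Module.finrank_fin_fun] at h2
    rw [Fintype.card_fin]
    lia
  obtain ⟨e⟩ := Function.Embedding.nonempty_of_card_le hcard
  have hz' : ∀ i, ∃ s ∈ S, c s = z i := fun i => hz ⟨i, rfl⟩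
  choose σ hσS hσ using hz'
  obtain ⟨i₀⟩ : Nonempty ι := by
    by_contra hne
    rw [not_nonempty_iff] at hne
    simp at hw1
  set s₀ := Function.extend e σ (fun _ => σ i₀) with hs₀
  set lam₀ := Function.extend e w 0 with hlam₀
  have hse : ∀ i, s₀ (e i) = σ i := fun i => e.injective.extend_apply _ _ _
  have hle : ∀ i, lam₀ (e i) = w i := fun i => e.injective.extend_apply _ _ _
  have hout : ∀ k, k ∉ Set.range e → lam₀ k = 0 := fun k hk =>
    Function.extend_apply' _ _ _ hk
  have hS : ∀ k, s₀ k ∈ S := fun k => by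
    by_cases hk : k ∈ Set.range e
    · obtain ⟨i, rfl⟩ := hk
      rw [hse]
      exact hσS i
    · rw [hs₀, Function.extend_apply' _ _ _ hk]
      exact hσS i₀
  have h0 : ∀ k, 0 ≤ lam₀ k := fun k => by
    by_cases hk : k ∈ Set.range e
    · obtain ⟨i, rfl⟩ := hk
      rw [hle]
      exact (hw i).le
    · exact (hout k hk).ge
  set τ := Tuple.sort fun k => -s₀ k
  refine ⟨s₀ ∘ τ, lam₀ ∘ τ, fun a b hab => ?_, fun k => hS _, fun k => h0 _, ?_, ?_⟩
  · exact neg_le_neg_iff.1 (Tuple.monotone_sort (fun k => -s₀ k) hab)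
  · simp only [Function.comp_apply]
    rw [Equiv.sum_comp τ lam₀, ← hw1]
    exact (Fintype.sum_of_injective e e.injective _ _ hout fun i => (hle i).symm).symm
  · simp only [Function.comp_apply]
    rw [Equiv.sum_comp τ fun k => lam₀ k • c (s₀ k), ← hwz]
    refine (Fintype.sum_of_injective e e.injective _ _ (fun k hk => ?_) fun i => ?_).symm
    · rw [hout k hk, zero_smul]
    · rw [hle, hse, hσ]

theorem rationalizes_of_sum_sectionMass {n m : ℕ} {U : ℝ → Set (Fin n → ℝ)}
    (hU : IsOpen {p : ℝ × (Fin n → ℝ) | p.2 ∈ U p.1}) {q : Fin n → ℝ → ℝ}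
    {s lam : Fin m → ℝ} (hlam : ∀ k, 0 ≤ lam k) (hlam1 : ∑ k, lam k = 1)
    (h : ∀ i, ∀ t ∈ Set.Ioc (0 : ℝ) 1, q i t = ∑ k, lam k * sectionMass unitLaw U i (s k) t) :
    RationalizesN n (fun x => ∑ k, lam k * (U (s k) ∩ cube n).indicator 1 x) q := by
  have hUs : ∀ s, MeasurableSet (U s) := fun s =>
    (hU.preimage (by fun_prop : Continuous fun x : Fin n → ℝ => (s, x))).measurableSet
  refine ⟨?_, fun x _ => ⟨?_, ?_⟩, fun i => ?_⟩
  · refine (Finset.measurable_sum _ fun k _ => Measurable.const_mul ?_ _).aemeasurable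
    exact measurable_one.indicator ((hUs _).inter measurableSet_Icc)
  · exact Finset.sum_nonneg fun k _ =>
      mul_nonneg (hlam k) (Set.indicator_nonneg (fun _ _ => zero_le_one) _)
  · rw [← hlam1]
    refine Finset.sum_le_sum fun k _ => mul_le_of_le_one_right (hlam k) ?_
    exact (le_abs_self _).trans (abs_indicator_one_le _ _)
  · filter_upwards [ae_mem_Ioc_unitLaw] with t ht
    have hcongr : ∫ x in cube n, ∑ k, lam k *
          (U (s k) ∩ cube n).indicator (1 : (Fin n → ℝ) → ℝ) (Function.update x i t) =
        ∫ x in cube n, ∑ k, lam k *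
          (U (s k)).indicator (fun _ => (1 : ℝ)) (Function.update x i t) := by
      refine setIntegral_congr_fun measurableSet_Icc fun x hx => ?_
      have hm : Function.update x i t ∈ cube n := by
        refine ⟨fun j => ?_, fun j => ?_⟩
        · by_cases hj : j = i
          · subst hj; simpa using ht.1.le
          · simpa [hj] using hx.1 j
        · by_cases hj : j = i
          · subst hj; simpa using ht.2
          · simpa [hj] using hx.2 j
      refine Finset.sum_congr rfl fun k _ => ?_
      by_cases hmk : Function.update x i t ∈ U (s k)
      · rw [Set.indicator_of_mem hmk, Set.indicator_of_mem (Set.mem_inter hmk hm), Pi.one_apply]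
      · rw [Set.indicator_of_notMem hmk, Set.indicator_of_notMem fun h' => hmk h'.1]
    rw [h i t ht, hcongr, volume_restrict_cube,
      integral_finsetSum _ fun k _ => (integrable_indicator_update hU i (s k) t).const_mul _]
    simp only [integral_const_mul, sectionMass]

/-- every extreme point of the set of rationalizable tuples subject to
`m` linear inequality constraints is rationalized by a mixture of at most `m + 1`
indicator functions of nested up-sets. -/
theorem stmt7 (n m : ℕ) (hn : 1 ≤ n)
    (ψ : Fin m → Fin n → ℝ → ℝ)
    (hmeas : ∀ j i, Measurable (ψ j i))
    (hbdd : ∀ j i, ∃ C : ℝ, ∀ᵐ t ∂(volume.restrict (Set.Icc (0 : ℝ) 1)), |ψ j i t| ≤ C)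
    (η : Fin m → ℝ)
    (q : Fin n → ℝ → ℝ)
    (hq : ExtremePtQN n
      {p | p ∈ QsetN n ∧
        ∀ j, (∑ i, ∫ t in Set.Icc (0 : ℝ) 1, p i t * ψ j i t) ≤ η j} q) :
    ∃ (A : Fin (m + 1) → Set (Fin n → ℝ)) (lam : Fin (m + 1) → ℝ),
      (∀ j, UpSetIn n (A j)) ∧
      (∀ j k, j ≤ k → A j ⊆ A k) ∧
      (∀ j, 0 ≤ lam j) ∧ (∑ j, lam j) = 1 ∧
      RationalizesN n (fun x => ∑ j, lam j * (A j).indicator 1 x) q := by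
  obtain ⟨U, hup, hanti, hU, hqU⟩ := exists_upSet_family hq.1.1
  set c : ℝ → Fin m → ℝ := fun s j => sectionFunctional U (ψ j) s with hc
  have hcm : ∀ j, Measurable fun s => c s j := fun j => measurable_sectionFunctional hU (hmeas j)
  have hcb : ∀ j, ∃ M, ∀ s, |c s j| ≤ M := fun j => exists_abs_sectionFunctional_le (hbdd j)
  have hcI : ∀ j, Integrable (fun s => c s j) unitLaw := fun j => by
    obtain ⟨M, hM⟩ := hcb j
    exact integrable_of_measurable_of_abs_le (hcm j) M hM
  have hrep : ∀ i, ∀ t ∈ Set.Ioc (0 : ℝ) 1, ∃ w : Option (Fin m) → ℝ, ∀ᵐ s ∂unitLaw,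
      sectionMass unitLaw U i s t = w none + ∑ j, w (some j) * c s j := by
    intro i t ht
    obtain ⟨w, hw⟩ := exists_eq_sum_of_orthogonal unitLaw
      (fun (o : Option (Fin m)) s => o.elim 1 (c s))
      (by rintro (_ | j); exacts [measurable_const, hcm j])
      (by rintro (_ | j); exacts [⟨1, by simp⟩, hcb j])
      (fun s => sectionMass unitLaw U i s t) (measurable_sectionMass_left hU i t)
      ⟨1, fun s => abs_sectionMass_le i s t⟩ fun h hh hh1 horth =>
        integral_mul_sectionMass_eq_zero_of_extreme hup hU hmeas hbdd hq hqU hh hh1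
          (by simpa using horth none) (fun j => by simpa using horth (some j)) i ht
    refine ⟨w, ?_⟩
    filter_upwards [hw] with s hs
    simpa [Fintype.sum_option] using hs
  choose! w hw using hrep
  set S : Set ℝ := {s | ∀ i, ∀ r : ℚ, (r : ℝ) ∈ Set.Ioc (0 : ℝ) 1 →
    sectionMass unitLaw U i s r = w i r none + ∑ j, w i r (some j) * c s j} with hS
  have hSae : ∀ᵐ s ∂unitLaw, s ∈ S := by
    rw [hS]
    refine ae_all_iff.2 fun i => ae_all_iff.2 fun r => ?_
    by_cases hr : (r : ℝ) ∈ Set.Ioc (0 : ℝ) 1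
    · filter_upwards [hw i r hr] with s hs _ using hs
    · exact Filter.Eventually.of_forall fun s h => absurd h hr
  have hmean : ∫ s, c s ∂unitLaw ∈ convexHull ℝ (c '' S) := by
    refine (convex_convexHull ℝ _).integral_mem_of_finiteDimensional unitLaw
      (Integrable.of_eval hcI) ?_
    filter_upwards [hSae] with s hs using subset_convexHull ℝ _ ⟨s, hs, rfl⟩
  obtain ⟨s, lam, hs, hsS, hlam, hlam1, hsum⟩ := exists_antitone_of_mem_convexHull_image hmean
  have hrat : ∀ i, ∀ t ∈ Set.range ((↑) : ℚ → ℝ), t ∈ Set.Ioc (0 : ℝ) 1 →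
      q i t = ∑ k, lam k * sectionMass unitLaw U i (s k) t := by
    rintro i _ ⟨r, rfl⟩ hr
    have hk : ∀ k, sectionMass unitLaw U i (s k) r =
        w i r none + ∑ j, w i r (some j) * c (s k) j := fun k => hsS k i r hr
    have hj : ∀ j, ∫ s, c s j ∂unitLaw = ∑ k, lam k * c (s k) j := fun j => by
      rw [← eval_integral hcI, ← hsum]
      simp
    rw [hqU i r hr, integral_congr_ae (hw i r hr), integral_add (integrable_const _)
      (integrable_finsetSum _ fun j _ => (hcI j).const_mul _),
      integral_finsetSum _ fun j _ => (hcI j).const_mul _]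
    simp only [integral_const_mul, hj, hk, mul_add, Finset.sum_add_distrib, ← Finset.sum_mul,
      hlam1, integral_const, probReal_univ, one_smul, one_mul, Finset.mul_sum]
    rw [Finset.sum_comm]
    congr 1
    exact Finset.sum_congr rfl fun k _ => Finset.sum_congr rfl fun j _ => by ring
  have hall : ∀ i, ∀ t ∈ Set.Ioc (0 : ℝ) 1,
      q i t = ∑ k, lam k * sectionMass unitLaw U i (s k) t := fun i =>
    eqOn_Ioc_of_leftContinuous_of_dense Rat.denseRange_cast (hq.1.1.1 i).2.2
      (fun t _ => tendsto_finsetSum _ fun k _ =>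
        (tendsto_sectionMass hU hup i (s k) t).const_mul _) (hrat i)
  exact ⟨fun k => U (s k) ∩ cube n, lam,
    fun k => ⟨Set.inter_subset_right, fun x hx y hy hxy => ⟨hup _ hxy hx.1, hy⟩⟩,
    fun j k hjk => Set.inter_subset_inter_left _ (hanti (hs hjk)), hlam, hlam1,
    rationalizes_of_sum_sectionMass hU hlam hlam1 hall⟩
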